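/- arXiv:1809.04827 — 3 statements merged into one kernel-verified Lean document; each statement's English description precedes it below -/
import Mathlib

section
/- For every prime number p ≥ 5, there exists an integer g with 1 ≤ g ≤ p−1 such that g is a primitive root modulo p and gcd(g, p−1) = 1. -/
/-- An integer `g` is a primitive root modulo `p`: its residue class generates the
multiplicative group of `ℤ/pℤ`, i.e. every nonzero residue is a power of `g`. -/
def IsPrimitiveRootModP (p : ℕ) (g : ℤ) : Prop :=
  ∀ a : ZMod p, a ≠ 0 → ∃ k : ℕ, (g : ZMod p) ^ k = a

namespace Brizolis

open Finset

theorem sum_mulChar_add_mul_inv {p : ℕ} [Fact p.Prime] {χ : MulChar (ZMod p) ℂ} (hχ : χ ≠ 1)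
    {b c : ZMod p} (hbc : b ≠ c) : ∑ x, χ (x + b) * χ⁻¹ (x + c) = -1 := by
  have hd : b - c ≠ 0 := sub_ne_zero.2 hbc
  have hbij : Function.Bijective fun u : ZMod p => -(b - c) * u - c := by
    refine Finite.injective_iff_bijective.1 fun u v huv => ?_
    exact mul_left_cancel₀ (neg_ne_zero.2 hd) (sub_left_injective huv)
  have hneg : χ⁻¹ (-1) * χ⁻¹ (-1) = 1 := by rw [← map_mul]; simp
  have hone : χ (b - c) * χ⁻¹ (b - c) = 1 := by
    rw [← MulChar.mul_apply, mul_inv_cancel, MulChar.one_apply (isUnit_iff_ne_zero.2 hd)]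
  calc ∑ x, χ (x + b) * χ⁻¹ (x + c)
      = ∑ u, χ (-(b - c) * u - c + b) * χ⁻¹ (-(b - c) * u - c + c) :=
        (hbij.sum_comp fun x => χ (x + b) * χ⁻¹ (x + c)).symm
    _ = ∑ u, χ⁻¹ (-1) * (χ⁻¹ u * χ (1 - u)) := by
        refine sum_congr rfl fun u _ => ?_
        rw [show -(b - c) * u - c + b = (b - c) * (1 - u) by ring,
          show -(b - c) * u - c + c = -1 * (b - c) * u by ring]
        simp only [map_mul]
        linear_combination (χ (1 - u) * χ⁻¹ (-1) * χ⁻¹ u) * hone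
    _ = χ⁻¹ (-1) * jacobiSum χ⁻¹ χ⁻¹⁻¹ := by rw [← mul_sum, inv_inv]; rfl
    _ = -1 := by
        rw [jacobiSum_nontrivial_inv (inv_ne_one.2 hχ), mul_neg, hneg]

theorem sum_norm_sq_sum_mulChar_le {p : ℕ} [Fact p.Prime] {χ : MulChar (ZMod p) ℂ} (hχ : χ ≠ 1)
    (B : Finset (ZMod p)) : ∑ x, ‖∑ b ∈ B, χ (x + b)‖ ^ 2 ≤ p * #B := by
  have hdiag : ∀ b : ZMod p, ∑ x, χ (x + b) * χ⁻¹ (x + b) = (p - 1 : ℂ) := by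
    intro b
    refine (Equiv.sum_comp (Equiv.addRight b) fun x => χ x * χ⁻¹ x).trans ?_
    simp only [← MulChar.mul_apply, mul_inv_cancel]
    rw [MulChar.sum_one_eq_card_units, ZMod.card_units_eq_totient,
      Nat.totient_prime Fact.out, Nat.cast_sub (Fact.out : p.Prime).one_le, Nat.cast_one]
  have hcast : ((∑ x, ‖∑ b ∈ B, χ (x + b)‖ ^ 2 : ℝ) : ℂ) =
      ∑ b ∈ B, ∑ c ∈ B, ∑ x, χ (x + b) * χ⁻¹ (x + c) := by
    push_cast
    simp only [← Complex.mul_conj', map_sum, ← MulChar.star_apply', RCLike.star_def, sum_mul_sum]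
    rw [sum_comm]
    exact sum_congr rfl fun b _ => sum_comm
  have hval : ((∑ x, ‖∑ b ∈ B, χ (x + b)‖ ^ 2 : ℝ) : ℂ) =
      ((∑ b ∈ B, ∑ c ∈ B, if b = c then (p - 1 : ℝ) else -1 : ℝ) : ℂ) := by
    rw [hcast]
    push_cast
    refine sum_congr rfl fun b _ => sum_congr rfl fun c _ => ?_
    split_ifs with h
    · rw [← h, hdiag]; simp
    · rw [sum_mulChar_add_mul_inv hχ h]; simp
  rw [Complex.ofReal_inj.1 hval]
  calc ∑ b ∈ B, ∑ c ∈ B, (if b = c then (p - 1 : ℝ) else -1)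
      ≤ ∑ b ∈ B, ∑ c ∈ B, (if b = c then (p : ℝ) else 0) := by
        gcongr with b _ c _
        split_ifs <;> linarith
    _ = p * #B := by simp [mul_comm]

theorem norm_sum_sum_mulChar_le {p : ℕ} [Fact p.Prime] {χ : MulChar (ZMod p) ℂ} (hχ : χ ≠ 1)
    (A B : Finset (ZMod p)) : ‖∑ a ∈ A, ∑ b ∈ B, χ (a + b)‖ ≤ √(p * (#A * #B)) := by
  refine Real.le_sqrt_of_sq_le ?_
  calc ‖∑ a ∈ A, ∑ b ∈ B, χ (a + b)‖ ^ 2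
      ≤ (∑ a ∈ A, ‖∑ b ∈ B, χ (a + b)‖) ^ 2 := by gcongr; exact norm_sum_le _ _
    _ ≤ #A * ∑ a ∈ A, ‖∑ b ∈ B, χ (a + b)‖ ^ 2 := sq_sum_le_card_mul_sum_sq
    _ ≤ #A * ∑ a, ‖∑ b ∈ B, χ (a + b)‖ ^ 2 := by
        gcongr
        exact subset_univ A
    _ ≤ #A * (p * #B) := by gcongr; exact sum_norm_sq_sum_mulChar_le hχ B
    _ = p * (#A * #B) := by ring

open Classical in
/-- On nonzero residues `f` is a combination of multiplicative characters of exponent `n`, with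
total weight `m` on the trivial character and `ℓ¹`-norm of the coefficients at most `N`. -/
def HasCharExpansion (p n : ℕ) (m N : ℝ) (f : ZMod p → ℝ) : Prop :=
  ∃ (ι : Type) (_ : Fintype ι) (c : ι → ℂ) (χ : ι → MulChar (ZMod p) ℂ),
    (∀ i, χ i ^ n = 1) ∧ (∀ x, x ≠ 0 → (f x : ℂ) = ∑ i, c i * χ i x) ∧
    (∑ i, if χ i = 1 then c i else 0) = m ∧ ∑ i, ‖c i‖ ≤ N

theorem hasCharExpansion_one (p : ℕ) [Fact p.Prime] : HasCharExpansion p 1 1 1 fun _ => 1 := by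
  refine ⟨Unit, inferInstance, fun _ => 1, fun _ => 1, by simp, fun x hx => ?_, by simp, by simp⟩
  simp [MulChar.one_apply (isUnit_iff_ne_zero.2 hx)]

open Classical in
theorem HasCharExpansion.mul {p n₁ n₂ : ℕ} {m₁ m₂ N₁ N₂ : ℝ} {f g : ZMod p → ℝ}
    (hf : HasCharExpansion p n₁ m₁ N₁ f) (hg : HasCharExpansion p n₂ m₂ N₂ g)
    (hn : n₁.Coprime n₂) :
    HasCharExpansion p (n₁ * n₂) (m₁ * m₂) (N₁ * N₂) fun x => f x * g x := by
  obtain ⟨ι, _, c, χ, hχ, hfx, hm, hN⟩ := hf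
  obtain ⟨κ, _, d, ψ, hψ, hgx, hm', hN'⟩ := hg
  have htriv : ∀ i j, χ i * ψ j = 1 ↔ χ i = 1 ∧ ψ j = 1 := by
    refine fun i j => ⟨fun h => ?_, fun h => by rw [h.1, h.2, one_mul]⟩
    have h1 : χ i = 1 := by
      rw [← orderOf_eq_one_iff, ← Nat.dvd_one, ← hn.gcd_eq_one]
      refine Nat.dvd_gcd (orderOf_dvd_of_pow_eq_one (hχ i)) (orderOf_dvd_of_pow_eq_one ?_)
      rw [eq_inv_of_mul_eq_one_left h, inv_pow, hψ, inv_one]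
    exact ⟨h1, by rwa [h1, one_mul] at h⟩
  refine ⟨ι × κ, inferInstance, fun i => c i.1 * d i.2, fun i => χ i.1 * ψ i.2, fun i => ?_,
    fun x hx => ?_, ?_, ?_⟩
  · rw [mul_pow, pow_mul, hχ, mul_comm n₁, pow_mul, hψ]; simp
  · push_cast
    rw [hfx x hx, hgx x hx, sum_mul_sum, Fintype.sum_prod_type]
    refine sum_congr rfl fun i _ => sum_congr rfl fun j _ => ?_
    rw [MulChar.mul_apply]; ring
  · push_cast
    rw [← hm, ← hm', sum_mul_sum, Fintype.sum_prod_type]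
    refine sum_congr rfl fun i _ => sum_congr rfl fun j _ => ?_
    simp only [htriv]
    by_cases h1 : χ i = 1 <;> by_cases h2 : ψ j = 1 <;> simp [h1, h2]
  · simp only [norm_mul, Fintype.sum_prod_type]
    rw [← sum_mul_sum]
    exact mul_le_mul hN hN' (by positivity) ((by positivity : (0:ℝ) ≤ ∑ i, ‖c i‖).trans hN)

open Classical in
theorem HasCharExpansion.abs_sum_sub_le {p n : ℕ} [Fact p.Prime] {m N : ℝ} {f : ZMod p → ℝ}
    (hf : HasCharExpansion p n m N f) (A B : Finset (ZMod p))
    (hAB : ∀ a ∈ A, ∀ b ∈ B, a + b ≠ 0) :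
    |∑ a ∈ A, ∑ b ∈ B, f (a + b) - m * (#A * #B)| ≤ (N - m) * √(p * (#A * #B)) := by
  obtain ⟨ι, _, c, χ, -, hfx, hm, hN⟩ := hf
  have hsum : ((∑ a ∈ A, ∑ b ∈ B, f (a + b) - m * (#A * #B) : ℝ) : ℂ) =
      ∑ i, if χ i = 1 then 0 else c i * ∑ a ∈ A, ∑ b ∈ B, χ i (a + b) := by
    have hone : ∀ i, χ i = 1 → ∑ a ∈ A, ∑ b ∈ B, χ i (a + b) = (#A * #B : ℂ) := by
      intro i hi
      rw [hi, sum_congr rfl fun a ha => sum_congr rfl fun b hb =>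
        MulChar.one_apply (isUnit_iff_ne_zero.2 (hAB a ha b hb))]
      simp
    have hall : ((∑ a ∈ A, ∑ b ∈ B, f (a + b) : ℝ) : ℂ) =
        ∑ i, c i * ∑ a ∈ A, ∑ b ∈ B, χ i (a + b) := by
      push_cast
      rw [sum_congr rfl fun a ha => sum_congr rfl fun b hb => hfx _ (hAB a ha b hb)]
      simp only [mul_sum]
      rw [sum_congr rfl fun a _ => sum_comm, sum_comm]
    rw [Complex.ofReal_sub, hall]
    push_cast
    rw [← hm, sum_mul, ← sum_sub_distrib]
    refine sum_congr rfl fun i _ => ?_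
    split_ifs with h
    · rw [hone i h, sub_self]
    · simp
  have hm' : m ≤ ∑ i, if χ i = 1 then ‖c i‖ else 0 := by
    calc m ≤ ‖(m : ℂ)‖ := by rw [Complex.norm_real]; exact le_abs_self m
      _ ≤ ∑ i, if χ i = 1 then ‖c i‖ else 0 := by
        rw [← hm]
        refine (norm_sum_le _ _).trans (sum_le_sum fun i _ => ?_)
        split_ifs <;> simp
  have hN' : (∑ i, if χ i = 1 then 0 else ‖c i‖) ≤ N - m := by
    have : (∑ i, if χ i = 1 then ‖c i‖ else 0) + (∑ i, if χ i = 1 then 0 else ‖c i‖) =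
        ∑ i, ‖c i‖ := by
      rw [← sum_add_distrib]
      exact sum_congr rfl fun i _ => by split_ifs <;> simp
    linarith
  rw [← Real.norm_eq_abs, ← Complex.norm_real, hsum]
  calc _ ≤ ∑ i, (if χ i = 1 then 0 else ‖c i‖) * √(p * (#A * #B)) := by
        refine (norm_sum_le _ _).trans (sum_le_sum fun i _ => ?_)
        split_ifs with h
        · simp
        · rw [norm_mul]
          gcongr
          exact norm_sum_sum_mulChar_le h A B
    _ ≤ _ := by
        rw [← sum_mul]
        gcongr

open Classical in
theorem hasCharExpansion_of_orderOf_eq {p l : ℕ} [Fact p.Prime] (hl : l.Prime)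
    {η : MulChar (ZMod p) ℂ} (hη : orderOf η = l) (α β : ℝ) :
    HasCharExpansion p l α (|α| + (l - 1) * |β|)
      fun x => α + β * ((if η x = 1 then (l : ℝ) else 0) - 1) := by
  have hl0 : 0 < l := hl.pos
  obtain ⟨k, rfl⟩ : ∃ k, l = k + 1 := ⟨l - 1, by omega⟩
  have hη1 : η ^ (k + 1) = 1 := by rw [← hη]; exact pow_orderOf_eq_one η
  refine ⟨Fin (k + 1), inferInstance, Fin.cons (α : ℂ) fun _ => (β : ℂ), fun j => η ^ (j : ℕ),
    fun j => ?_, fun x hx => ?_, ?_, ?_⟩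
  · rw [← pow_mul, mul_comm, pow_mul, hη1, one_pow]
  · have hpow : ∀ j : ℕ, (η ^ j) x = η x ^ j := by
      intro j
      have := congrArg (fun u : ℂ => u) (MulChar.pow_apply_coe η j (Units.mk0 x hx))
      simpa using this
    have hxl : η x ^ (k + 1) = 1 := by
      rw [← hpow, hη1, MulChar.one_apply (isUnit_iff_ne_zero.2 hx)]
    have hgeom : ∑ j ∈ range (k + 1), η x ^ j = if η x = 1 then ((k + 1 : ℕ) : ℂ) else 0 := by
      split_ifs with h
      · simp [h]
      · rw [geom_sum_eq h, hxl, sub_self, zero_div]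
    have hgeom' : ∑ j : Fin k, η x ^ ((j : ℕ) + 1) =
        (if η x = 1 then ((k + 1 : ℕ) : ℂ) else 0) - 1 := by
      rw [← hgeom, sum_range_succ', Fin.sum_univ_eq_sum_range fun j => η x ^ (j + 1)]
      simp
    simp only [hpow, Fin.sum_univ_succ, Fin.cons_zero, Fin.cons_succ, Fin.val_zero, Fin.val_succ,
      pow_zero, mul_one, ← mul_sum, hgeom']
    push_cast
    split_ifs <;> simp
  · rw [Fin.sum_univ_succ]
    have : ∀ j : Fin k, η ^ ((j : ℕ) + 1) ≠ 1 := by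
      intro j h
      have := Nat.le_of_dvd (by omega) (orderOf_dvd_of_pow_eq_one h)
      omega
    simp [this]
  · simp [Fin.sum_univ_succ]

open Classical in
theorem hasCharExpansion_ite_one_zero {p l : ℕ} [Fact p.Prime] (hl : l.Prime)
    {η : MulChar (ZMod p) ℂ} (hη : orderOf η = l) :
    HasCharExpansion p l (1 - (l : ℝ)⁻¹) (2 * (1 - (l : ℝ)⁻¹))
      fun x => if η x = 1 then 0 else 1 := by
  have hl0 : (0 : ℝ) < l := by exact_mod_cast hl.pos
  have hl1 : (l : ℝ)⁻¹ ≤ 1 := inv_le_one_of_one_le₀ (by exact_mod_cast hl.one_le)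
  convert hasCharExpansion_of_orderOf_eq hl hη (1 - (l : ℝ)⁻¹) (-(l : ℝ)⁻¹) using 1
  · rw [abs_of_nonneg (by linarith), abs_neg, abs_of_pos (by positivity)]
    field_simp
    ring
  · ext x
    split_ifs <;> field_simp <;> ring

open Classical in
theorem hasCharExpansion_ite_sub_inv {p l : ℕ} [Fact p.Prime] (hl : l.Prime)
    {η : MulChar (ZMod p) ℂ} (hη : orderOf η = l) :
    HasCharExpansion p l 0 1 fun x => (if η x = 1 then 1 else 0) - (l : ℝ)⁻¹ := by
  have hl0 : (0 : ℝ) < l := by exact_mod_cast hl.pos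
  obtain ⟨ι, _, c, χ, h1, h2, h3, h4⟩ := hasCharExpansion_of_orderOf_eq hl hη 0 (l : ℝ)⁻¹
  refine ⟨ι, _, c, χ, h1, fun x hx => ?_, h3, h4.trans ?_⟩
  · rw [← h2 x hx]
    congr 1
    dsimp only
    split_ifs <;> field_simp <;> ring
  · rw [abs_zero, abs_of_pos (by positivity)]
    field_simp
    linarith

open Classical in
theorem hasCharExpansion_prod {p : ℕ} [Fact p.Prime] {η : ℕ → MulChar (ZMod p) ℂ} {E : Finset ℕ}
    (hE : ∀ l ∈ E, l.Prime) (hη : ∀ l ∈ E, orderOf (η l) = l) :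
    HasCharExpansion p (∏ l ∈ E, l) (∏ l ∈ E, (1 - (l : ℝ)⁻¹))
      (2 ^ #E * ∏ l ∈ E, (1 - (l : ℝ)⁻¹)) fun x => ∏ l ∈ E, if η l x = 1 then 0 else 1 := by
  induction E using Finset.induction_on with
  | empty => simpa using hasCharExpansion_one p
  | insert l E hl ih =>
    simp only [mem_insert, forall_eq_or_imp] at hE hη
    simp only [prod_insert hl, card_insert_of_notMem hl]
    convert (hasCharExpansion_ite_one_zero hE.1 hη.1).mul (ih hE.2 hη.2) ?_ using 1
    · ring
    · exact Nat.Coprime.prod_right fun m hm =>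
        (Nat.coprime_primes hE.1 (hE.2 m hm)).2 fun h => hl (h ▸ hm)

theorem HasCharExpansion.abs_sum_natCast_sub_le {p n : ℕ} [Fact p.Prime] {m N : ℝ}
    {f : ZMod p → ℝ} (hf : HasCharExpansion p n m N f) {A B : Finset ℕ}
    (hAB : ∀ a ∈ A, ∀ b ∈ B, 0 < a + b ∧ a + b < p) :
    |∑ a ∈ A, ∑ b ∈ B, f (a + b) - m * (#A * #B)| ≤ (N - m) * √(p * (#A * #B)) := by
  have hinj : ∀ {x y : ℕ}, x < p → y < p → (x : ZMod p) = y → x = y := fun hx hy h =>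
    Nat.ModEq.eq_of_lt_of_lt ((ZMod.natCast_eq_natCast_iff _ _ _).1 h) hx hy
  obtain rfl | ⟨a₀, ha₀⟩ := A.eq_empty_or_nonempty
  · simp
  obtain rfl | ⟨b₀, hb₀⟩ := B.eq_empty_or_nonempty
  · simp
  have hA : Set.InjOn (Nat.cast : ℕ → ZMod p) A := fun x hx y hy h => by
    have := hAB x hx b₀ hb₀
    have := hAB y hy b₀ hb₀
    exact hinj (by omega) (by omega) h
  have hB : Set.InjOn (Nat.cast : ℕ → ZMod p) B := fun x hx y hy h => by
    have := hAB a₀ ha₀ x hx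
    have := hAB a₀ ha₀ y hy
    exact hinj (by omega) (by omega) h
  have := hf.abs_sum_sub_le (A.image Nat.cast) (B.image Nat.cast) (by
    simp only [mem_image, forall_exists_index, and_imp, forall_apply_eq_imp_iff₂]
    intro a ha b hb h
    have h1 := hAB a ha b hb
    exact h1.1.ne (hinj h1.2 (Fact.out : p.Prime).pos (by exact_mod_cast h)).symm)
  simpa only [sum_image hA, sum_image hB, card_image_of_injOn hA, card_image_of_injOn hB] using this

theorem HasCharExpansion.sum_filter_dvd_le {p n : ℕ} [Fact p.Prime] {m N : ℝ}
    {f : ZMod p → ℝ} (hf : HasCharExpansion p n m N f) {A B : Finset ℕ}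
    (hAB : ∀ a ∈ A, ∀ b ∈ B, 0 < a + b ∧ a + b < p) (hm : 0 ≤ m) (hmN : m ≤ N)
    {l : ℕ} [NeZero l] {c : ℝ} (hc : ∀ r : ZMod l, #(A.filter fun a : ℕ => (a : ZMod l) = r) ≤ c) :
    ∑ a ∈ A, ∑ b ∈ B, (if l ∣ a + b then f (a + b) else 0) ≤
      m * (c * #B) + (N - m) * √(p * (#A * #B)) := by
  let A' (r : ZMod l) := A.filter fun a : ℕ => (a : ZMod l) = r
  let B' (r : ZMod l) := B.filter fun b : ℕ => -(b : ZMod l) = r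
  have hA' : ∑ r, (#(A' r) : ℝ) = #A := by
    rw [← Nat.cast_sum, ← card_eq_sum_card_fiberwise fun _ _ => mem_coe.2 (mem_univ _)]
  have hB' : ∑ r, (#(B' r) : ℝ) = #B := by
    rw [← Nat.cast_sum, ← card_eq_sum_card_fiberwise fun _ _ => mem_coe.2 (mem_univ _)]
  have hsplit : ∑ a ∈ A, ∑ b ∈ B, (if l ∣ a + b then f (a + b) else 0) =
      ∑ r, ∑ a ∈ A' r, ∑ b ∈ B' r, f (a + b) := by
    rw [← sum_fiberwise A (fun a => (a : ZMod l))]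
    refine sum_congr rfl fun r _ => sum_congr rfl fun a ha => ?_
    rw [sum_filter]
    refine sum_congr rfl fun b _ => if_congr ?_ rfl rfl
    rw [← (mem_filter.1 ha).2, ← ZMod.natCast_eq_zero_iff, Nat.cast_add,
      neg_eq_iff_add_eq_zero, add_comm]
  have hr : ∀ r, ∑ a ∈ A' r, ∑ b ∈ B' r, f (a + b) ≤
      m * (c * #(B' r)) + (N - m) * √p * (√(#(A' r)) * √(#(B' r))) := by
    intro r
    have h1 := hf.abs_sum_natCast_sub_le (A := A' r) (B := B' r) fun a ha b hb =>
      hAB a (mem_filter.1 ha).1 b (mem_filter.1 hb).1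
    rw [Real.sqrt_mul (Nat.cast_nonneg _), Real.sqrt_mul (Nat.cast_nonneg _), ← mul_assoc] at h1
    have h2 : m * (#(A' r) * #(B' r)) ≤ m * (c * #(B' r)) := by
      gcongr
      exact hc r
    linarith [le_of_abs_le h1]
  have hsqrt : ∑ r, √(#(A' r)) * √(#(B' r)) ≤ √(#A) * √(#B) := by
    rw [← hA', ← hB']
    exact Real.sum_sqrt_mul_sqrt_le _ (fun _ => Nat.cast_nonneg _) fun _ => Nat.cast_nonneg _
  rw [hsplit, Real.sqrt_mul (Nat.cast_nonneg _), Real.sqrt_mul (Nat.cast_nonneg _),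
    ← mul_assoc (N - m)]
  refine (sum_le_sum fun r _ => hr r).trans ?_
  rw [sum_add_distrib, ← mul_sum, ← mul_sum, ← mul_sum, hB']
  exact add_le_add_right (mul_le_mul_of_nonneg_left hsqrt <|
    mul_nonneg (sub_nonneg.2 hmN) (Real.sqrt_nonneg _)) _

/-- The sieve: character sums produce a sum `a + b` which is coprime to all primes of `P` and is
not killed by any of the characters `η l`. -/
theorem exists_add_not_dvd_and_mulChar_ne_one {p : ℕ} [Fact p.Prime] {P E F A B : Finset ℕ}
    {η : ℕ → MulChar (ZMod p) ℂ} (hP : ∀ l ∈ P, l.Prime) (hη : ∀ l ∈ P, orderOf (η l) = l)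
    (hE : E ⊆ P) (hA : A.Nonempty) (hB : B.Nonempty)
    (hAB : ∀ a ∈ A, ∀ b ∈ B, 0 < a + b ∧ a + b < p)
    (hF : ∀ l ∈ F, ∀ a ∈ A, ∀ b ∈ B, ¬ l ∣ a + b) {m : ℝ}
    (hm : ∀ l ∈ P \ F, ∀ r : ZMod l,
      #(A.filter fun a : ℕ => (a : ZMod l) = r) ≤ #A * ((l : ℝ)⁻¹ + m⁻¹))
    (hσ : ∑ l ∈ P \ E, (l : ℝ)⁻¹ ≤ 1)
    (h : 0 < (1 - ∑ l ∈ P \ E, (l : ℝ)⁻¹) * (√(#A * #B) - (2 ^ #E - 1) * √p)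
      - 2 ^ #E * #(P \ E) * √p
      - ∑ l ∈ P \ F, (√(#A * #B) * ((l : ℝ)⁻¹ + m⁻¹) + (2 ^ #E - 1) * √p)) :
    ∃ a ∈ A, ∃ b ∈ B, ∀ l ∈ P, ¬ l ∣ a + b ∧ η l ((a + b : ℕ) : ZMod p) ≠ 1 := by
  classical
  by_contra! hcon
  set θ := ∏ l ∈ E, (1 - (l : ℝ)⁻¹)
  have hθ : 0 < θ := prod_pos fun l hl =>
    sub_pos.2 (inv_lt_one_of_one_lt₀ (by exact_mod_cast (hP l (hE hl)).one_lt))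
  have h2 : (1 : ℝ) ≤ 2 ^ #E := one_le_pow₀ one_le_two
  set S := √(#A * #B)
  set ρ : ZMod p → ℝ := fun x => ∏ l ∈ E, if η l x = 1 then 0 else 1
  have hρ : HasCharExpansion p (∏ l ∈ E, l) θ (2 ^ #E * θ) ρ :=
    hasCharExpansion_prod (fun l hl => hP l (hE hl)) fun l hl => hη l (hE hl)
  have hρ0 : ∀ x, 0 ≤ ρ x := fun x => prod_nonneg fun l _ => by split_ifs <;> norm_num
  have hsqrt : √(p * (#A * #B)) = √p * S := Real.sqrt_mul (Nat.cast_nonneg _) _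
  have hSS : (#A * #B : ℝ) = S * S := (Real.mul_self_sqrt (by positivity)).symm
  have hmain : θ * (S * (S - (2 ^ #E - 1) * √p)) ≤ ∑ a ∈ A, ∑ b ∈ B, ρ (a + b) := by
    have := neg_le_of_abs_le (hρ.abs_sum_natCast_sub_le hAB)
    rw [hsqrt, hSS] at this
    linarith
  have hbad : ∀ l ∈ P \ E, ∑ a ∈ A, ∑ b ∈ B,
      ρ (a + b) * ((if η l (a + b) = 1 then 1 else 0) - (l : ℝ)⁻¹) ≤ θ * (S * (2 ^ #E * √p)) := by
    intro l hl
    rw [mem_sdiff] at hl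
    have := le_of_abs_le ((hρ.mul (hasCharExpansion_ite_sub_inv (hP l hl.1) (hη l hl.1))
      (Nat.Coprime.prod_left fun m hm => (Nat.coprime_primes (hP m (hE hm)) (hP l hl.1)).2
        fun h => hl.2 (h ▸ hm))).abs_sum_natCast_sub_le hAB)
    rw [hsqrt, hSS] at this
    linarith
  have hdvd : ∀ l ∈ P \ F, ∑ a ∈ A, ∑ b ∈ B, (if l ∣ a + b then ρ (a + b) else 0) ≤
      θ * (S * (S * ((l : ℝ)⁻¹ + m⁻¹) + (2 ^ #E - 1) * √p)) := by
    intro l hl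
    have : NeZero l := ⟨(hP l (mem_sdiff.1 hl).1).ne_zero⟩
    have := hρ.sum_filter_dvd_le hAB hθ.le (le_mul_of_one_le_left hθ.le h2) (hm l hl)
    rw [hsqrt] at this
    calc _ ≤ _ := this
      _ = θ * ((#A * #B) * ((l : ℝ)⁻¹ + m⁻¹) + (2 ^ #E - 1) * √p * S) := by ring
      _ = _ := by rw [hSS]; ring
  have hpoint : ∀ a ∈ A, ∀ b ∈ B, ρ (a + b) * (1 - ∑ l ∈ P \ E, (l : ℝ)⁻¹) ≤
      ∑ l ∈ P \ E, ρ (a + b) * ((if η l (a + b) = 1 then 1 else 0) - (l : ℝ)⁻¹) +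
      ∑ l ∈ P \ F, if l ∣ a + b then ρ (a + b) else 0 := by
    intro a ha b hb
    have h1 : 0 ≤ ∑ l ∈ P \ F, if l ∣ a + b then ρ (a + b) else 0 :=
      sum_nonneg fun l _ => by split_ifs; exacts [hρ0 _, le_rfl]
    have h2 : 0 ≤ ∑ l ∈ P \ E, ρ (a + b) * (if η l (a + b) = 1 then 1 else 0) :=
      sum_nonneg fun l _ => mul_nonneg (hρ0 _) (by split_ifs <;> norm_num)
    simp only [mul_sub, sum_sub_distrib, mul_one]
    rw [← mul_sum _ fun l : ℕ => (l : ℝ)⁻¹]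
    suffices ρ (a + b) ≤ ∑ l ∈ P \ E, ρ (a + b) * (if η l (a + b) = 1 then 1 else 0) +
      ∑ l ∈ P \ F, if l ∣ a + b then ρ (a + b) else 0 by linarith
    obtain ⟨l, hl, hl'⟩ := hcon a ha b hb
    push_cast at hl'
    by_cases hd : l ∣ a + b
    · have hlF : l ∈ P \ F := mem_sdiff.2 ⟨hl, fun hlF => hF l hlF a ha b hb hd⟩
      have := single_le_sum (f := fun l => if l ∣ a + b then ρ (a + b) else 0)
        (fun i _ => by split_ifs; exacts [hρ0 _, le_rfl]) hlF
      simp only [hd, if_true] at this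
      linarith
    · have hη1 := hl' hd
      by_cases hlE : l ∈ E
      · have : ρ (a + b) = 0 := prod_eq_zero hlE (if_pos hη1)
        linarith
      · have := single_le_sum (f := fun l => ρ (a + b) * (if η l (a + b) = 1 then 1 else 0))
          (fun i _ => mul_nonneg (hρ0 _) (by split_ifs <;> norm_num)) (mem_sdiff.2 ⟨hl, hlE⟩)
        simp only [hη1, if_true, mul_one] at this
        linarith
  have htotal : (∑ a ∈ A, ∑ b ∈ B, ρ (a + b)) * (1 - ∑ l ∈ P \ E, (l : ℝ)⁻¹) ≤
      ∑ l ∈ P \ E, θ * (S * (2 ^ #E * √p)) +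
      ∑ l ∈ P \ F, θ * (S * (S * ((l : ℝ)⁻¹ + m⁻¹) + (2 ^ #E - 1) * √p)) := by
    calc _ = ∑ a ∈ A, ∑ b ∈ B, ρ (a + b) * (1 - ∑ l ∈ P \ E, (l : ℝ)⁻¹) := by
          simp only [sum_mul]
      _ ≤ _ := sum_le_sum fun a ha => sum_le_sum fun b hb => hpoint a ha b hb
      _ = ∑ l ∈ P \ E, ∑ a ∈ A, ∑ b ∈ B,
            ρ (a + b) * ((if η l (a + b) = 1 then 1 else 0) - (l : ℝ)⁻¹) +
          ∑ l ∈ P \ F, ∑ a ∈ A, ∑ b ∈ B, if l ∣ a + b then ρ (a + b) else 0 := by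
        simp only [sum_add_distrib]
        congr 1 <;>
        · rw [sum_congr rfl fun a _ => sum_comm, sum_comm]
      _ ≤ _ := add_le_add (sum_le_sum hbad) (sum_le_sum hdvd)
  have hfinal := (mul_le_mul_of_nonneg_right hmain (sub_nonneg.2 hσ)).trans htotal
  rw [sum_const, nsmul_eq_mul, ← mul_sum, ← mul_sum] at hfinal
  have hS : 0 < S := Real.sqrt_pos.2 <|
    mul_pos (Nat.cast_pos.2 hA.card_pos) (Nat.cast_pos.2 hB.card_pos)
  have := mul_pos (mul_pos hθ hS) h
  linarith

theorem exists_card_eq_prod_forall_mod_mem {F : Finset ℕ} (hF : ∀ l ∈ F, l.Prime)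
    (R : ℕ → Finset ℕ) (hR : ∀ l ∈ F, ∀ r ∈ R l, r < l) :
    ∃ A : Finset ℕ, #A = ∏ l ∈ F, #(R l) ∧ (∀ a ∈ A, a < ∏ l ∈ F, l) ∧
      ∀ a ∈ A, ∀ l ∈ F, a % l ∈ R l := by
  classical
  have hne : ∀ l ∈ F, l ≠ 0 := fun l hl => (hF l hl).ne_zero
  have hco : Set.Pairwise (F : Set ℕ) (Function.onFun Nat.Coprime id) := fun l hl k hk hlk =>
    (Nat.coprime_primes (hF l hl) (hF k hk)).2 hlk
  let a (g : ∀ l ∈ F, ℕ) : ℕ := Nat.chineseRemainderOfFinset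
    (fun l => if h : l ∈ F then g l h else 0) id F hne hco
  have ha : ∀ g ∈ F.pi R, ∀ l (hl : l ∈ F), a g % l = g l hl := by
    intro g hg l hl
    have := (Nat.chineseRemainderOfFinset
      (fun l => if h : l ∈ F then g l h else 0) id F hne hco).2 l hl
    simp only [hl, dif_pos, id] at this
    rwa [Nat.ModEq, Nat.mod_eq_of_lt (hR l hl _ (mem_pi.1 hg l hl))] at this
  refine ⟨(F.pi R).image a, ?_, ?_, ?_⟩
  · rw [card_image_of_injOn, card_pi]
    intro g hg h hh hgh
    ext l hl
    rw [← ha g hg l hl, ← ha h hh l hl]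
    exact congrArg (· % l) hgh
  · simp only [mem_image, forall_exists_index, and_imp, forall_apply_eq_imp_iff₂]
    exact fun g _ => Nat.chineseRemainderOfFinset_lt_prod _ _ hne hco
  · simp only [mem_image, forall_exists_index, and_imp, forall_apply_eq_imp_iff₂]
    intro g hg l hl
    rw [ha g hg l hl]
    exact mem_pi.1 hg l hl

theorem card_filter_range_natCast_eq_le (m l : ℕ) [NeZero l] (s : ZMod l) :
    (#((range m).filter fun i : ℕ => (i : ZMod l) = s) : ℝ) ≤ m * (l : ℝ)⁻¹ + 1 := by
  have h : #((range m).filter fun i : ℕ => (i : ZMod l) = s) ≤ m / l + 1 := by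
    have h1 := Nat.count_modEq_card m (NeZero.pos l) s.val
    rw [Nat.count_eq_card_filter_range] at h1
    have h2 : ((range m).filter fun i : ℕ => (i : ZMod l) = s) =
        (range m).filter fun i : ℕ => i ≡ s.val [MOD l] := by
      refine filter_congr fun i _ => ?_
      rw [← ZMod.natCast_eq_natCast_iff, ZMod.natCast_zmod_val]
    rw [h2, h1]
    split_ifs <;> omega
  calc _ ≤ ((m / l : ℕ) : ℝ) + 1 := by exact_mod_cast h
    _ ≤ _ := by
      rw [← div_eq_mul_inv]
      gcongr
      exact Nat.cast_div_le

theorem exists_periodic_extension {A₀ : Finset ℕ} {M m : ℕ} (hm : 0 < m)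
    (hA₀ : ∀ a ∈ A₀, a < M) :
    ∃ A : Finset ℕ, #A = m * #A₀ ∧ (∀ a ∈ A, a + 1 ≤ M * m ∧ a % M ∈ A₀) ∧
      ∀ l : ℕ, l.Prime → l.Coprime M → ∀ r : ZMod l,
        #(A.filter fun a : ℕ => (a : ZMod l) = r) ≤ #A * ((l : ℝ)⁻¹ + (m : ℝ)⁻¹) := by
  classical
  have hinj : Set.InjOn (fun x : ℕ × ℕ => x.1 + M * x.2) (A₀ ×ˢ range m : Finset (ℕ × ℕ)) := by
    rintro ⟨a, i⟩ hx ⟨b, j⟩ hy h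
    simp only [coe_product, Set.mem_prod, mem_coe] at hx hy
    have ha := hA₀ a hx.1
    have hb := hA₀ b hy.1
    have h1 : a = b := by
      have := congrArg (· % M) h
      simpa [Nat.mod_eq_of_lt ha, Nat.mod_eq_of_lt hb] using this
    subst h1
    simpa [(Nat.zero_lt_of_lt ha).ne'] using h
  have hcard : #((A₀ ×ˢ range m).image fun x : ℕ × ℕ => x.1 + M * x.2) = m * #A₀ := by
    rw [card_image_of_injOn hinj, card_product, card_range, mul_comm]
  refine ⟨(A₀ ×ˢ range m).image fun x => x.1 + M * x.2, hcard, ?_, fun l hl hlM r => ?_⟩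
  · simp only [mem_image, mem_product, mem_range, Prod.exists]
    rintro _ ⟨a, i, ⟨ha, hi⟩, rfl⟩
    have h1 := hA₀ a ha
    refine ⟨?_, by rwa [Nat.add_mul_mod_self_left, Nat.mod_eq_of_lt h1]⟩
    have := Nat.mul_le_mul_left M (Nat.succ_le_of_lt hi)
    rw [Nat.mul_succ] at this
    omega
  · have := Fact.mk hl
    have hM : (M : ZMod l) ≠ 0 := by
      rw [Ne, ZMod.natCast_eq_zero_iff]
      exact fun h => hl.one_lt.ne' (Nat.dvd_one.1 (hlM ▸ Nat.dvd_gcd dvd_rfl h))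
    have hcount : (#(((A₀ ×ˢ range m).image fun x => x.1 + M * x.2).filter
        fun a : ℕ => (a : ZMod l) = r) : ℝ) ≤ #A₀ * (m * (l : ℝ)⁻¹ + 1) := by
      rw [filter_image, card_image_of_injOn (hinj.mono (coe_subset.2 (filter_subset _ _))),
        card_filter, sum_product]
      push_cast
      rw [← nsmul_eq_mul]
      refine sum_le_card_nsmul _ _ _ fun a _ => ?_
      refine le_trans (le_of_eq ?_) (card_filter_range_natCast_eq_le m l ((r - a) / M))
      rw [card_filter]
      push_cast
      refine sum_congr rfl fun i _ => if_congr ?_ rfl rfl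
      rw [eq_div_iff hM, eq_sub_iff_add_eq, mul_comm, add_comm]
    refine hcount.trans (le_of_eq ?_)
    rw [hcard]
    have : (m : ℝ) ≠ 0 := by positivity
    push_cast
    field_simp

theorem exists_sumset_not_dvd {p m : ℕ} {F : Finset ℕ} (hF : ∀ l ∈ F, l.Prime)
    (hF₀ : F.Nonempty) (hm : 0 < m) (hp : 2 * ((∏ l ∈ F, l) * m) ≤ p) :
    ∃ A B : Finset ℕ, #A = m * ∏ l ∈ F, l / 2 ∧ #B = m * ∏ l ∈ F, (l - l / 2) ∧
      (∀ a ∈ A, ∀ b ∈ B, 0 < a + b ∧ a + b < p) ∧ (∀ l ∈ F, ∀ a ∈ A, ∀ b ∈ B, ¬ l ∣ a + b) ∧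
      ∀ l : ℕ, l.Prime → l ∉ F → ∀ r : ZMod l,
        #(A.filter fun a : ℕ => (a : ZMod l) = r) ≤ #A * ((l : ℝ)⁻¹ + (m : ℝ)⁻¹) := by
  obtain ⟨A₀, hA₀, hAM, hAR⟩ := exists_card_eq_prod_forall_mod_mem hF (fun l => range (l / 2))
    fun l hl r hr => (mem_range.1 hr).trans (Nat.div_lt_self (hF l hl).pos one_lt_two)
  obtain ⟨B₀, hB₀, hBM, hBR⟩ := exists_card_eq_prod_forall_mod_mem hF
    (fun l => Ioc 0 (l - l / 2)) fun l hl r hr => by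
      have := mem_Ioc.1 hr
      have := (hF l hl).two_le
      omega
  obtain ⟨A, hA, hA', hAl⟩ := exists_periodic_extension hm hAM
  obtain ⟨B, hB, hB', -⟩ := exists_periodic_extension hm hBM
  have hndvd : ∀ l ∈ F, ∀ a ∈ A, ∀ b ∈ B, ¬ l ∣ a + b := by
    intro l hl a ha b hb h
    have h1 := hAR _ (hA' a ha).2 l hl
    have h2 := hBR _ (hB' b hb).2 l hl
    rw [Nat.mod_mod_of_dvd _ (dvd_prod_of_mem _ hl), mem_range] at h1
    rw [Nat.mod_mod_of_dvd _ (dvd_prod_of_mem _ hl), mem_Ioc] at h2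
    rw [Nat.dvd_iff_mod_eq_zero, Nat.add_mod, Nat.mod_eq_of_lt (by omega)] at h
    omega
  refine ⟨A, B, by simp [hA, hA₀], by simp [hB, hB₀], fun a ha b hb => ⟨?_, ?_⟩, hndvd,
    fun l hl hlF => hAl l hl ?_⟩
  · obtain ⟨l, hl⟩ := hF₀
    exact Nat.pos_of_ne_zero fun h => hndvd l hl a ha b hb (h ▸ dvd_zero l)
  · have := (hA' a ha).1
    have := (hB' b hb).1
    omega
  · exact Nat.Coprime.prod_right fun k hk =>
      (Nat.coprime_primes hl (hF k hk)).2 fun h => hlF (h ▸ hk)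

/-- A primitive root `g` of `p` coprime to `p - 1`, in a form which is easy to test. -/
def HasCoprimeRoot (p : ℕ) : Prop :=
  ∃ g : ℕ, g < p ∧ g.Coprime (p - 1) ∧
    ∀ l, l.Prime → l ∣ p - 1 → (g : ZMod p) ^ ((p - 1) / l) ≠ 1

theorem mulChar_eq_one_of_pow_eq_one {p l : ℕ} [Fact p.Prime] (hl : l ∣ p - 1)
    {η : MulChar (ZMod p) ℂ} (hη : orderOf η = l) {x : ZMod p} (hx : x ^ ((p - 1) / l) = 1) :
    η x = 1 := by
  have hp1 : 0 < p - 1 := Nat.sub_pos_of_lt (Fact.out : p.Prime).one_lt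
  obtain ⟨d, hd⟩ := hl
  have hl0 : 0 < l := Nat.pos_of_mul_pos_right (hd ▸ hp1)
  have hd0 : 0 < d := Nat.pos_of_mul_pos_left (hd ▸ hp1)
  rw [hd, Nat.mul_div_cancel_left d hl0] at hx
  have hu : IsUnit x := IsUnit.of_pow_eq_one hx hd0.ne'
  obtain ⟨u, rfl⟩ := hu
  obtain ⟨z, hz⟩ := IsCyclic.exists_generator (α := (ZMod p)ˣ)
  have hcard : orderOf z = l * d := by
    rw [orderOf_eq_card_of_forall_mem_zpowers hz, Nat.card_eq_fintype_card,
      ZMod.card_units_eq_totient, Nat.totient_prime Fact.out, hd]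
  obtain ⟨i, rfl⟩ := (mem_powers_iff_mem_zpowers.2 (hz u) : u ∈ Submonoid.powers z)
  have hli : l ∣ i := by
    rw [← Units.val_pow_eq_pow_val, Units.val_eq_one, ← pow_mul] at hx
    have := orderOf_dvd_of_pow_eq_one hx
    rw [hcard] at this
    exact Nat.dvd_of_mul_dvd_mul_right hd0 this
  obtain ⟨j, rfl⟩ := hli
  dsimp only
  have h1 : η ^ l = 1 := hη ▸ pow_orderOf_eq_one η
  rw [mul_comm, pow_mul, Units.val_pow_eq_pow_val, map_pow, ← MulChar.pow_apply_coe, h1,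
    MulChar.one_apply_coe]

/-- The square root of the proportion of pairs of residues modulo `l` used by the sieve. -/
noncomputable def weight (l : ℕ) : ℝ := √((l / 2 : ℕ) * (l - l / 2 : ℕ)) / l

theorem hasCoprimeRoot_of_sieve {p : ℕ} (hp : p.Prime) (h5 : 5 ≤ p) {E F : Finset ℕ}
    (hE : E ⊆ (p - 1).primeFactors) (hF : F ⊆ (p - 1).primeFactors) (hF₀ : F.Nonempty)
    (hM : (∏ l ∈ F, l) ^ 2 ≤ p)
    (hσ : ∑ l ∈ (p - 1).primeFactors \ E, (l : ℝ)⁻¹ +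
      ∑ l ∈ (p - 1).primeFactors \ F, (l : ℝ)⁻¹ ≤ 1)
    (h : (1 - ∑ l ∈ (p - 1).primeFactors \ E, (l : ℝ)⁻¹) * (2 ^ #E - 1) +
        2 ^ #E * #((p - 1).primeFactors \ E) + #((p - 1).primeFactors \ F) * (2 ^ #E - 1) <
      (∏ l ∈ F, weight l) * ((√p / 2 - 1) * (1 - ∑ l ∈ (p - 1).primeFactors \ E, (l : ℝ)⁻¹ -
        ∑ l ∈ (p - 1).primeFactors \ F, (l : ℝ)⁻¹) - #((p - 1).primeFactors \ F))) :
    HasCoprimeRoot p := by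
  have := Fact.mk hp
  set P := (p - 1).primeFactors
  have hP : ∀ l ∈ P, l.Prime := fun l hl => Nat.prime_of_mem_primeFactors hl
  have hex : ∀ l, ∃ η : MulChar (ZMod p) ℂ, l ∈ P → orderOf η = l := by
    intro l
    by_cases hl : l ∈ P
    · have hl0 : l ≠ 0 := (hP l hl).ne_zero
      obtain ⟨η, hη⟩ := MulChar.exists_mulChar_orderOf (ZMod p) (n := l) (R := ℂ)
        (by rw [ZMod.card]; exact Nat.dvd_of_mem_primeFactors hl)
        (Complex.isPrimitiveRoot_exp l hl0)
      exact ⟨η, fun _ => hη⟩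
    · exact ⟨1, fun h => absurd h hl⟩
  choose η hη using hex
  set M := ∏ l ∈ F, l
  have hM0 : 0 < M := prod_pos fun l hl => (hP l (hF hl)).pos
  set m := p / (2 * M)
  have hmle : 2 * (M * m) ≤ p := by
    rw [← mul_assoc]
    exact Nat.mul_div_le p (2 * M)
  have hmlt : p < 2 * M * m + 2 * M := by
    have := Nat.lt_mul_div_succ p (show 0 < 2 * M by positivity)
    rwa [Nat.mul_succ] at this
  have hm : 0 < m := by
    refine Nat.div_pos ?_ (by positivity)
    rcases Nat.lt_or_ge M 3 with h3 | h3 <;> nlinarith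
  obtain ⟨A, B, hA, hB, hAB, hndvd, hcount⟩ :=
    exists_sumset_not_dvd (fun l hl => hP l (hF hl)) hF₀ hm hmle
  have hhalf : ∀ l ∈ F, 0 < l / 2 ∧ 0 < l - l / 2 := fun l hl => by
    have := (hP l (hF hl)).two_le
    omega
  have hA0 : A.Nonempty :=
    card_pos.1 (hA ▸ Nat.mul_pos hm (prod_pos fun l hl => (hhalf l hl).1))
  have hB0 : B.Nonempty :=
    card_pos.1 (hB ▸ Nat.mul_pos hm (prod_pos fun l hl => (hhalf l hl).2))
  set W := ∏ l ∈ F, weight l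
  have hW0 : 0 ≤ W := prod_nonneg fun l _ => by unfold weight; positivity
  have hS : √(#A * #B) = m * M * W := by
    have h1 : (∏ l ∈ F, ((l / 2 : ℕ) : ℝ)) * ∏ l ∈ F, ((l - l / 2 : ℕ) : ℝ) = (M * W) ^ 2 := by
      rw [Nat.cast_prod, ← prod_mul_distrib, ← prod_mul_distrib, ← prod_pow]
      refine prod_congr rfl fun l hl => ?_
      have : (l : ℝ) ≠ 0 := by exact_mod_cast (hP l (hF hl)).ne_zero
      rw [weight, mul_div_cancel₀ _ this, Real.sq_sqrt (by positivity)]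
    have h2 : (#A * #B : ℝ) = (m * M * W) ^ 2 := by
      rw [hA, hB, Nat.cast_mul, Nat.cast_mul, Nat.cast_prod, Nat.cast_prod]
      linear_combination (m : ℝ) ^ 2 * h1
    rw [h2, Real.sqrt_sq (by positivity)]
  have hp0 : 0 < √(p : ℝ) := Real.sqrt_pos.2 (by exact_mod_cast hp.pos)
  have hpp : √(p : ℝ) * √p = p := Real.mul_self_sqrt (Nat.cast_nonneg _)
  have hMp : (M : ℝ) ≤ √p := Real.le_sqrt_of_sq_le (by exact_mod_cast hM)
  have hmM : √p * (√p / 2 - 1) ≤ m * M := by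
    have : (p : ℝ) < 2 * M * m + 2 * M := by exact_mod_cast hmlt
    nlinarith
  set σE := ∑ l ∈ P \ E, (l : ℝ)⁻¹
  set σF := ∑ l ∈ P \ F, (l : ℝ)⁻¹
  have hσF : 0 ≤ σF := sum_nonneg fun l _ => by positivity
  obtain ⟨a, ha, b, hb, hab⟩ := exists_add_not_dvd_and_mulChar_ne_one (m := m) hP hη hE hA0 hB0 hAB
    hndvd (fun l hl => hcount l (hP l (mem_sdiff.1 hl).1) (mem_sdiff.1 hl).2) (by linarith) (by
      rw [sum_add_distrib, ← mul_sum, sum_add_distrib, sum_const, sum_const, nsmul_eq_mul,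
        nsmul_eq_mul, hS]
      have h1 := mul_lt_mul_of_pos_left h hp0
      have h2 : √p * (√p / 2 - 1) * (W * (1 - σE - σF)) ≤ m * M * (W * (1 - σE - σF)) :=
        mul_le_mul_of_nonneg_right hmM (mul_nonneg hW0 (by linarith))
      have h3 : m * M * W * (#(P \ F) * (m : ℝ)⁻¹) ≤ √p * (W * #(P \ F)) := by
        have : (m : ℝ) ≠ 0 := by positivity
        calc m * M * W * (#(P \ F) * (m : ℝ)⁻¹) = M * (W * #(P \ F)) := by field_simp
          _ ≤ _ := mul_le_mul_of_nonneg_right hMp (by positivity)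
      linarith)
  refine ⟨a + b, (hAB a ha b hb).2, Nat.Coprime.symm ?_, fun l hl hlp hpow => ?_⟩
  · refine Nat.coprime_of_dvd fun l hl hlp => (hab l ?_).1
    exact Nat.mem_primeFactors.2 ⟨hl, hlp, by omega⟩
  · have hlP : l ∈ P := Nat.mem_primeFactors.2 ⟨hl, hlp, by omega⟩
    exact (hab l hlP).2 (mulChar_eq_one_of_pow_eq_one hlp (hη l hlP) hpow)

theorem nth_prime_add_le_of_strictMono {L : ℕ → ℕ} {k a j : ℕ} (hL : ∀ i < k, (L i).Prime)
    (hmono : ∀ i j, i < j → j < k → L i < L j) (hj : Nat.nth Nat.Prime (j + a) ≤ L j) {i : ℕ}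
    (hji : j ≤ i) (hi : i < k) : Nat.nth Nat.Prime (i + a) ≤ L i := by
  have hcount : i + a ≤ Nat.count Nat.Prime (L i) := by
    induction i, hji using Nat.le_induction with
    | base =>
      calc j + a = Nat.count Nat.Prime (Nat.nth Nat.Prime (j + a)) :=
            (Nat.count_nth_of_infinite Nat.infinite_setOfPred_prime _).symm
        _ ≤ _ := Nat.count_monotone _ hj
    | succ i hji ih =>
      calc i + 1 + a = i + a + 1 := by ring
        _ ≤ Nat.count Nat.Prime (L i) + 1 := Nat.succ_le_succ (ih (by omega))
        _ = Nat.count Nat.Prime (L i + 1) := by rw [Nat.count_succ, if_pos (hL i (by omega))]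
        _ ≤ _ := Nat.count_monotone _ (hmono i (i + 1) (by omega) hi)
  calc Nat.nth Nat.Prime (i + a) ≤ Nat.nth Nat.Prime (Nat.count Nat.Prime (L i)) :=
        Nat.nth_monotone Nat.infinite_setOfPred_prime hcount
    _ = L i := Nat.nth_count (hL i hi)

theorem nth_prime_le_of_strictMono {L : ℕ → ℕ} {k : ℕ} (hL : ∀ i < k, (L i).Prime)
    (hmono : ∀ i j, i < j → j < k → L i < L j) {i : ℕ} (hi : i < k) :
    Nat.nth Nat.Prime i ≤ L i :=
  nth_prime_add_le_of_strictMono (a := 0) (j := 0) hL hmono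
    (by simpa using (hL 0 (by omega)).two_le) (Nat.zero_le i) hi

/-- The primes other than the one of index `j`, in increasing order. -/
noncomputable def nthPrimeOmitting (j i : ℕ) : ℕ := Nat.nth Nat.Prime (if i < j then i else i + 1)

theorem nthPrimeOmitting_le {n k j : ℕ} (hn : ¬ Nat.nth Nat.Prime j ∣ n) {L : ℕ → ℕ}
    (hL : ∀ i < k, (L i).Prime ∧ L i ∣ n) (hmono : ∀ i j, i < j → j < k → L i < L j) (i : ℕ)
    (hi : i < k) : nthPrimeOmitting j i ≤ L i := by
  have hL' : ∀ i < k, (L i).Prime := fun i hi => (hL i hi).1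
  rw [nthPrimeOmitting]
  split_ifs with hij
  · exact nth_prime_le_of_strictMono hL' hmono hi
  · rw [not_lt] at hij
    refine nth_prime_add_le_of_strictMono hL' hmono ?_ hij hi
    have hjk : j < k := by omega
    have hlt : Nat.nth Nat.Prime j < L j :=
      (nth_prime_le_of_strictMono hL' hmono hjk).lt_of_ne fun h => hn (h ▸ (hL j hjk).2)
    calc Nat.nth Nat.Prime (j + 1) ≤ Nat.nth Nat.Prime (Nat.count Nat.Prime (L j)) := by
          refine Nat.nth_monotone Nat.infinite_setOfPred_prime ?_
          calc j + 1 = Nat.count Nat.Prime (Nat.nth Nat.Prime j) + 1 := by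
                rw [Nat.count_nth_of_infinite Nat.infinite_setOfPred_prime]
            _ = Nat.count Nat.Prime (Nat.nth Nat.Prime j + 1) := by
                rw [Nat.count_succ, if_pos (Nat.prime_nth_prime j)]
            _ ≤ _ := Nat.count_monotone _ hlt
      _ = L j := Nat.nth_count (hL' j hjk)

theorem exists_sorted_enumeration (s : Finset ℕ) :
    ∃ L : ℕ → ℕ, (∀ i j, i < j → j < #s → L i < L j) ∧ (range #s).image L = s := by
  refine ⟨Nat.nth (· ∈ s), fun i j hij hj => ?_, ?_⟩
  · refine Nat.nth_lt_nth' hij fun hf => ?_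
    simpa using hj
  · ext x
    simp only [mem_image, mem_range]
    constructor
    · rintro ⟨i, hi, rfl⟩
      exact Nat.nth_mem (p := (· ∈ s)) i fun hf => by simpa using hi
    · intro hx
      obtain ⟨n, hn, rfl⟩ := Nat.exists_lt_card_nth_eq (p := (· ∈ s)) hx
      exact ⟨n, by simpa using hn s.finite_toSet, rfl⟩

theorem weight_two : weight 2 = 1 / 2 := by simp [weight]

theorem le_weight_of_odd {c : ℝ} {n l : ℕ} (hn : 0 < n) (hnl : n ≤ l) (hl : Odd l)
    (hc : c ^ 2 ≤ (1 - ((n : ℝ)⁻¹) ^ 2) / 4) : c ≤ weight l := by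
  obtain ⟨j, rfl⟩ := hl
  have hl0 : (0 : ℝ) < (2 * j + 1 : ℕ) := by positivity
  rw [weight, le_div_iff₀ hl0, show (2 * j + 1) / 2 = j by omega,
    show 2 * j + 1 - j = j + 1 by omega]
  refine Real.le_sqrt_of_sq_le ?_
  have h1 : (((2 * j + 1 : ℕ) : ℝ)⁻¹) ^ 2 ≤ ((n : ℝ)⁻¹) ^ 2 := by gcongr
  calc (c * (2 * j + 1 : ℕ)) ^ 2 = c ^ 2 * ((2 * j + 1 : ℕ) : ℝ) ^ 2 := by ring
    _ ≤ ((1 - (((2 * j + 1 : ℕ) : ℝ)⁻¹) ^ 2) / 4) * ((2 * j + 1 : ℕ) : ℝ) ^ 2 := by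
        gcongr
        linarith
    _ = _ := by
        field_simp
        push_cast
        ring

/-- The numerical criterion obtained from the sieve, in terms of the number `k` of prime factors
of `p - 1`. -/
theorem hasCoprimeRoot_of_lt {p k e f : ℕ} {m : ℕ → ℕ} {c : ℕ → ℝ} {r σ τ : ℝ} (hp : p.Prime)
    (h5 : 5 ≤ p) (hk : #(p - 1).primeFactors = k) (he : e ≤ k) (hf : 0 < f) (hfk : f ≤ k)
    (hfk' : f = 1 ∨ 2 * f ≤ k) (hm₀ : ∀ i, 0 < m i)
    (hm : ∀ L : ℕ → ℕ, (∀ i < k, (L i).Prime ∧ L i ∣ p - 1) → (∀ i j, i < j → j < k → L i < L j) →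
      ∀ i < k, m i ≤ L i)
    (hc : ∀ i, 0 ≤ c i) (hc₀ : c 0 ≤ 1 / 2)
    (hc₁ : ∀ i < f, 0 < i → c i ^ 2 ≤ (1 - ((m i : ℝ)⁻¹) ^ 2) / 4)
    (hσ : ∑ i ∈ Ico e k, (m i : ℝ)⁻¹ ≤ σ) (hτ : ∑ i ∈ Ico f k, (m i : ℝ)⁻¹ ≤ τ)
    (hστ : σ + τ < 1) (hr : r ^ 2 ≤ p)
    (h : (1 - σ) * (2 ^ e - 1) + 2 ^ e * (k - e) + (k - f) * (2 ^ e - 1) <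
      (∏ i ∈ range f, c i) * ((r / 2 - 1) * (1 - σ - τ) - (k - f))) :
    HasCoprimeRoot p := by
  obtain ⟨L, hmono, hL⟩ := exists_sorted_enumeration (p - 1).primeFactors
  rw [hk] at hmono hL
  have hq0 : p - 1 ≠ 0 := by omega
  have hLP : ∀ i < k, L i ∈ (p - 1).primeFactors := fun i hi =>
    hL ▸ mem_image_of_mem L (mem_range.2 hi)
  have hprime : ∀ i < k, (L i).Prime := fun i hi => Nat.prime_of_mem_primeFactors (hLP i hi)
  have hmL : ∀ i < k, m i ≤ L i :=
    hm L (fun i hi => ⟨hprime i hi, Nat.dvd_of_mem_primeFactors (hLP i hi)⟩) hmono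
  have hinj : Set.InjOn L (range k) := fun i hi j hj hij => by
    simp only [coe_range, Set.mem_Iio] at hi hj
    rcases lt_trichotomy i j with h | h | h
    · exact absurd hij (hmono i j h hj).ne
    · exact h
    · exact absurd hij (hmono j i h hi).ne'
  have hinj' : ∀ {s : Finset ℕ}, s ⊆ range k → Set.InjOn L s := fun hs =>
    hinj.mono (coe_subset.2 hs)
  have hsub : ∀ {n}, n ≤ k → range n ⊆ range k := fun hn => range_subset_range.2 hn
  have hsub' : ∀ {n}, Ico n k ⊆ range k := by
    intro n i hi
    exact mem_range.2 (mem_Ico.1 hi).2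
  have hcompl : ∀ {n}, n ≤ k → (p - 1).primeFactors \ (range n).image L = (Ico n k).image L := by
    intro n hn
    rw [← hL, ← image_sdiff_of_injOn hinj (hsub hn), range_eq_Ico, range_eq_Ico,
      Ico_sdiff_Ico_left, max_eq_right (Nat.zero_le n)]
  have hL0 : L 0 = 2 := by
    have h2 : 2 ∈ (p - 1).primeFactors := by
      refine Nat.mem_primeFactors.2 ⟨Nat.prime_two, ?_, hq0⟩
      have := hp.eq_two_or_odd
      omega
    rw [← hL] at h2
    obtain ⟨i, hi, hi2⟩ := mem_image.1 h2
    have h1 := (hprime 0 (by omega)).two_le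
    rcases Nat.eq_zero_or_pos i with rfl | hi0
    · exact hi2
    · have := hmono 0 i hi0 (mem_range.1 hi)
      omega
  have hsum : ∀ n, ∑ l ∈ (Ico n k).image L, (l : ℝ)⁻¹ ≤
      ∑ i ∈ Ico n k, (m i : ℝ)⁻¹ := by
    intro n
    rw [sum_image (hinj' hsub')]
    refine sum_le_sum fun i hi => ?_
    have := hm₀ i
    have := hmL i (mem_Ico.1 hi).2
    gcongr
  have hcard : ∀ {n}, n ≤ k → (#((Ico n k).image L) : ℝ) = k - n := by
    intro n hn
    rw [card_image_of_injOn (hinj' hsub'), Nat.card_Ico, Nat.cast_sub hn]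
  have hW : ∏ i ∈ range f, c i ≤ ∏ l ∈ (range f).image L, weight l := by
    rw [prod_image (hinj' (hsub hfk))]
    refine prod_le_prod (fun i _ => hc i) fun i hi => ?_
    have hif := mem_range.1 hi
    rcases Nat.eq_zero_or_pos i with rfl | hi0
    · rwa [hL0, weight_two]
    · refine le_weight_of_odd (hm₀ i) (hmL i (by omega)) ?_ (hc₁ i hif hi0)
      refine (hprime i (by omega)).odd_of_ne_two ?_
      have := hmono 0 i hi0 (by omega)
      omega
  have hM : (∏ l ∈ (range f).image L, l) ^ 2 ≤ p := by
    rw [prod_image (hinj' (hsub hfk))]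
    rcases hfk' with rfl | hfk'
    · rw [prod_range_one, hL0]
      omega
    · have hle : ∏ i ∈ range f, L i ≤ ∏ i ∈ range f, L (f + i) :=
        prod_le_prod (fun _ _ => Nat.zero_le _) fun i hi =>
          (hmono i (f + i) (by omega) (by have := mem_range.1 hi; omega)).le
      calc (∏ i ∈ range f, L i) ^ 2 ≤ (∏ i ∈ range f, L i) * ∏ i ∈ range f, L (f + i) := by
            rw [sq]
            exact Nat.mul_le_mul_left _ hle
        _ = ∏ i ∈ range (2 * f), L i := by rw [two_mul, prod_range_add]
        _ ≤ ∏ i ∈ range k, L i := by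
            refine prod_le_prod_of_subset_of_one_le' (hsub hfk') fun i hi _ =>
              (hprime i (mem_range.1 hi)).pos
        _ = ∏ l ∈ (p - 1).primeFactors, l := by
            rw [← hL, prod_image hinj]
        _ ≤ p - 1 := Nat.le_of_dvd (Nat.pos_of_ne_zero hq0) (Nat.prod_primeFactors_dvd _)
        _ ≤ p := Nat.sub_le _ _
  have hrp : r ≤ √p := Real.le_sqrt_of_sq_le hr
  refine hasCoprimeRoot_of_sieve hp h5 (E := (range e).image L) (F := (range f).image L)
    (fun l hl => ?_) (fun l hl => ?_) ?_ hM ?_ ?_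
  · obtain ⟨i, hi, rfl⟩ := mem_image.1 hl
    exact hLP i ((mem_range.1 hi).trans_le he)
  · obtain ⟨i, hi, rfl⟩ := mem_image.1 hl
    exact hLP i ((mem_range.1 hi).trans_le hfk)
  · exact ⟨L 0, mem_image_of_mem L (mem_range.2 hf)⟩
  · rw [hcompl he, hcompl hfk]
    linarith [hsum e, hsum f]
  · rw [hcompl he, hcompl hfk, hcard he, hcard hfk, card_image_of_injOn (hinj' (hsub he)),
      card_range]
    have hσ' := (hsum e).trans hσ
    have hτ' := (hsum f).trans hτ
    have hτ0 : 0 ≤ ∑ l ∈ (Ico f k).image L, (l : ℝ)⁻¹ := sum_nonneg fun l _ => by positivity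
    have hσ0 : 0 ≤ ∑ l ∈ (Ico e k).image L, (l : ℝ)⁻¹ := sum_nonneg fun l _ => by positivity
    have hD : (0 : ℝ) ≤ 2 ^ e - 1 := sub_nonneg.2 (one_le_pow₀ one_le_two)
    have hW0 : 0 ≤ ∏ i ∈ range f, c i := prod_nonneg fun i _ => hc i
    have hke : (0 : ℝ) ≤ k - e := sub_nonneg.2 (Nat.cast_le.2 he)
    have hkf : (0 : ℝ) ≤ k - f := sub_nonneg.2 (Nat.cast_le.2 hfk)
    generalize ∑ l ∈ (Ico e k).image L, (l : ℝ)⁻¹ = x at *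
    generalize ∑ l ∈ (Ico f k).image L, (l : ℝ)⁻¹ = y at *
    generalize ∏ i ∈ range f, c i = W at *
    generalize ∏ l ∈ (range f).image L, weight l = W' at *
    have he2 : (0 : ℝ) ≤ 2 ^ e * (k - e) := by positivity
    generalize (2 : ℝ) ^ e * (k - e) = z at *
    generalize (2 : ℝ) ^ e - 1 = D at *
    generalize (k : ℝ) - f = s at *
    have hsD : 0 ≤ s * D := mul_nonneg hkf hD
    have hlow : (1 - σ - τ) * D ≤ (1 - σ) * D :=
      mul_le_mul_of_nonneg_right (by linarith) hD
    have hWs : 0 ≤ W * s := mul_nonneg hW0 hkf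
    have hWu : D < W * (r / 2 - 1) := by
      refine lt_of_mul_lt_mul_left ?_ (by linarith : 0 ≤ 1 - σ - τ)
      linarith
    have hX : 0 < W * ((r / 2 - 1) * (1 - σ - τ) - s) := by
      have : 0 ≤ (1 - σ - τ) * D := mul_nonneg (by linarith) hD
      linarith
    have hX' := pos_of_mul_pos_right hX hW0
    have hu : 0 ≤ r / 2 - 1 := by
      by_contra hneg
      nlinarith
    have h1 : (r / 2 - 1) * (1 - σ - τ) + (r / 2 - 1) * (σ - x) ≤
        (√p / 2 - 1) * (1 - x - y) := by
      calc _ ≤ (r / 2 - 1) * (1 - x - y) := by nlinarith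
        _ ≤ _ := by
          gcongr
          linarith
    have h2 : 0 ≤ (W * (r / 2 - 1) - D) * (σ - x) :=
      mul_nonneg (by linarith) (by linarith)
    have h3 : W * ((√p / 2 - 1) * (1 - x - y) - s) ≤ W' * ((√p / 2 - 1) * (1 - x - y) - s) := by
      refine mul_le_mul_of_nonneg_right hW ?_
      have := mul_nonneg hu (sub_nonneg.2 hσ')
      linarith
    have h4 := mul_le_mul_of_nonneg_left h1 hW0
    linarith

theorem nth_prime_five_eq_thirteen : Nat.nth Nat.Prime 5 = 13 :=
  Nat.nth_count (by norm_num : Nat.Prime 13)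

theorem nth_prime_six_eq_seventeen : Nat.nth Nat.Prime 6 = 17 :=
  Nat.nth_count (by norm_num : Nat.Prime 17)

theorem nth_prime_seven_eq_nineteen : Nat.nth Nat.Prime 7 = 19 :=
  Nat.nth_count (by norm_num : Nat.Prime 19)

theorem nth_prime_eight_eq_twenty_three : Nat.nth Nat.Prime 8 = 23 :=
  Nat.nth_count (by norm_num : Nat.Prime 23)

theorem nth_prime_nine_eq_twenty_nine : Nat.nth Nat.Prime 9 = 29 :=
  Nat.nth_count (by norm_num : Nat.Prime 29)

theorem nth_prime_ten_eq_thirty_one : Nat.nth Nat.Prime 10 = 31 :=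
  Nat.nth_count (by norm_num : Nat.Prime 31)

theorem nth_prime_eleven_eq_thirty_seven : Nat.nth Nat.Prime 11 = 37 :=
  Nat.nth_count (by norm_num : Nat.Prime 37)

attribute [local simp] Nat.nth_prime_zero_eq_two Nat.nth_prime_one_eq_three
  Nat.nth_prime_two_eq_five Nat.nth_prime_three_eq_seven Nat.nth_prime_four_eq_eleven
  nth_prime_five_eq_thirteen nth_prime_six_eq_seventeen nth_prime_seven_eq_nineteen
  nth_prime_eight_eq_twenty_three nth_prime_nine_eq_twenty_nine nth_prime_ten_eq_thirty_one
  nth_prime_eleven_eq_thirty_seven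

/-- Lower bounds for `weight` at the first four primes. -/
noncomputable def weightBound (i : ℕ) : ℝ := [1 / 2, 0.4714, 0.4898, 0.4948].getD i 0

theorem weightBound_nonneg (i : ℕ) : 0 ≤ weightBound i := by
  rcases i with _ | _ | _ | _ | i <;> norm_num [weightBound]

theorem weightBound_sq_le {i m : ℕ} (hi : 0 < i) (hi4 : i < 4) (hm : Nat.nth Nat.Prime i ≤ m) :
    weightBound i ^ 2 ≤ (1 - ((m : ℝ)⁻¹) ^ 2) / 4 := by
  have h0 : 0 < Nat.nth Nat.Prime i := (Nat.prime_nth_prime i).pos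
  have h : weightBound i ^ 2 ≤ (1 - ((Nat.nth Nat.Prime i : ℝ)⁻¹) ^ 2) / 4 := by
    interval_cases i <;> norm_num [weightBound]
  refine h.trans ?_
  gcongr

theorem hasCoprimeRoot_of_weightBound {p k r : ℕ} {m : ℕ → ℕ} (hp : p.Prime) (h5 : 5 ≤ p)
    (hk : #(p - 1).primeFactors = k)
    (hm : ∀ L : ℕ → ℕ, (∀ i < k, (L i).Prime ∧ L i ∣ p - 1) →
      (∀ i j, i < j → j < k → L i < L j) → ∀ i < k, m i ≤ L i)
    (hm' : ∀ i, Nat.nth Nat.Prime i ≤ m i) (hr : r ^ 2 ≤ p) (e f : ℕ) (σ τ : ℝ) (he : e ≤ k)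
    (hf : 0 < f) (hfk : f ≤ k) (hfk' : f = 1 ∨ 2 * f ≤ k) (hf4 : f ≤ 4)
    (hσ : ∑ i ∈ Ico e k, (m i : ℝ)⁻¹ ≤ σ) (hτ : ∑ i ∈ Ico f k, (m i : ℝ)⁻¹ ≤ τ) (hστ : σ + τ < 1)
    (h : (1 - σ) * (2 ^ e - 1) + 2 ^ e * (k - e) + (k - f) * (2 ^ e - 1) <
      (∏ i ∈ range f, weightBound i) * (((r : ℝ) / 2 - 1) * (1 - σ - τ) - (k - f))) :
    HasCoprimeRoot p :=
  hasCoprimeRoot_of_lt hp h5 hk he hf hfk hfk'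
    (fun i => (Nat.prime_nth_prime i).pos.trans_le (hm' i)) hm weightBound_nonneg
    (by norm_num [weightBound]) (fun i hi hi0 => weightBound_sq_le hi0 (by omega) (hm' i)) hσ hτ
    hστ (by exact_mod_cast hr) h

theorem nth_prime_le_nthPrimeOmitting (j i : ℕ) : Nat.nth Nat.Prime i ≤ nthPrimeOmitting j i := by
  rw [nthPrimeOmitting]
  split_ifs
  · exact le_rfl
  · exact Nat.nth_monotone Nat.infinite_setOfPred_prime i.le_succ

/-- If `p - 1` has `k ≤ 8` prime factors and its least prime nondivisor is the one with index
`j`, where `1 ≤ j ≤ k`, the sieve succeeds once `p` is at least the square of this number. -/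
def sieveBound (k j : ℕ) : ℕ :=
  ([[], [0, 7],
    [0, 31, 42],
    [0, 100, 145, 191],
    [0, 233, 270, 339, 447],
    [0, 535, 535, 761, 1019, 1102],
    [0, 1006, 1006, 1355, 1924, 2103, 2298],
    [0, 1987, 1987, 2444, 3347, 3645, 4119, 4312],
    [0, 3376, 3376, 3929, 5534, 6217, 7413, 7936, 8480]].getD k []).getD j 0

theorem hasCoprimeRoot_of_sieveBound_sq_le {p k j : ℕ} (hp : p.Prime) (h5 : 5 ≤ p)
    (hk : #(p - 1).primeFactors = k) (hj : ¬ Nat.nth Nat.Prime j ∣ p - 1) (hj₀ : 0 < j)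
    (hjk : j ≤ k) (hk₈ : k ≤ 8) (h : sieveBound k j ^ 2 ≤ p) : HasCoprimeRoot p := by
  have key := hasCoprimeRoot_of_weightBound hp h5 hk (fun L => nthPrimeOmitting_le hj)
    (nth_prime_le_nthPrimeOmitting j) h
  clear hk h hj
  have hk₀ : 0 < k := by omega
  interval_cases k <;> interval_cases j
  · apply key 1 1 (0) (0) <;>
      norm_num [sum_Ico_eq_sum_range, sum_range_succ, prod_range_succ, sieveBound,
        weightBound, nthPrimeOmitting]
  · apply key 1 1 (1/5) (1/5) <;>
      norm_num [sum_Ico_eq_sum_range, sum_range_succ, prod_range_succ, sieveBound,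
        weightBound, nthPrimeOmitting]
  · apply key 2 1 (0) (1667/5000) <;>
      norm_num [sum_Ico_eq_sum_range, sum_range_succ, prod_range_succ, sieveBound,
        weightBound, nthPrimeOmitting]
  · apply key 1 1 (3429/10000) (3429/10000) <;>
      norm_num [sum_Ico_eq_sum_range, sum_range_succ, prod_range_succ, sieveBound,
        weightBound, nthPrimeOmitting]
  · apply key 2 1 (1429/10000) (2381/5000) <;>
      norm_num [sum_Ico_eq_sum_range, sum_range_succ, prod_range_succ, sieveBound,
        weightBound, nthPrimeOmitting]
  · apply key 3 1 (0) (2667/5000) <;>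
      norm_num [sum_Ico_eq_sum_range, sum_range_succ, prod_range_succ, sieveBound,
        weightBound, nthPrimeOmitting]
  · apply key 1 2 (2169/5000) (1169/5000) <;>
      norm_num [sum_Ico_eq_sum_range, sum_range_succ, prod_range_succ, sieveBound,
        weightBound, nthPrimeOmitting]
  · apply key 2 2 (1169/5000) (1169/5000) <;>
      norm_num [sum_Ico_eq_sum_range, sum_range_succ, prod_range_succ, sieveBound,
        weightBound, nthPrimeOmitting]
  · apply key 2 2 (291/1000) (291/1000) <;>
      norm_num [sum_Ico_eq_sum_range, sum_range_succ, prod_range_succ, sieveBound,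
        weightBound, nthPrimeOmitting]
  · apply key 2 2 (3429/10000) (3429/10000) <;>
      norm_num [sum_Ico_eq_sum_range, sum_range_succ, prod_range_succ, sieveBound,
        weightBound, nthPrimeOmitting]
  · apply key 2 2 (3107/10000) (3107/10000) <;>
      norm_num [sum_Ico_eq_sum_range, sum_range_succ, prod_range_succ, sieveBound,
        weightBound, nthPrimeOmitting]
  · apply key 2 2 (3107/10000) (3107/10000) <;>
      norm_num [sum_Ico_eq_sum_range, sum_range_succ, prod_range_succ, sieveBound,
        weightBound, nthPrimeOmitting]
  · apply key 2 2 (3679/10000) (3679/10000) <;>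
      norm_num [sum_Ico_eq_sum_range, sum_range_succ, prod_range_succ, sieveBound,
        weightBound, nthPrimeOmitting]
  · apply key 3 2 (1099/5000) (2099/5000) <;>
      norm_num [sum_Ico_eq_sum_range, sum_range_succ, prod_range_succ, sieveBound,
        weightBound, nthPrimeOmitting]
  · apply key 3 2 (1169/5000) (2169/5000) <;>
      norm_num [sum_Ico_eq_sum_range, sum_range_succ, prod_range_succ, sieveBound,
        weightBound, nthPrimeOmitting]
  · apply key 2 2 (231/625) (231/625) <;>
      norm_num [sum_Ico_eq_sum_range, sum_range_succ, prod_range_succ, sieveBound,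
        weightBound, nthPrimeOmitting]
  · apply key 2 2 (231/625) (231/625) <;>
      norm_num [sum_Ico_eq_sum_range, sum_range_succ, prod_range_succ, sieveBound,
        weightBound, nthPrimeOmitting]
  · apply key 2 3 (4267/10000) (2267/10000) <;>
      norm_num [sum_Ico_eq_sum_range, sum_range_succ, prod_range_succ, sieveBound,
        weightBound, nthPrimeOmitting]
  · apply key 2 3 (4787/10000) (2787/10000) <;>
      norm_num [sum_Ico_eq_sum_range, sum_range_succ, prod_range_succ, sieveBound,
        weightBound, nthPrimeOmitting]
  · apply key 3 3 (1463/5000) (1463/5000) <;>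
      norm_num [sum_Ico_eq_sum_range, sum_range_succ, prod_range_succ, sieveBound,
        weightBound, nthPrimeOmitting]
  · apply key 3 3 (3107/10000) (3107/10000) <;>
      norm_num [sum_Ico_eq_sum_range, sum_range_succ, prod_range_succ, sieveBound,
        weightBound, nthPrimeOmitting]
  · apply key 2 3 (2111/5000) (2793/10000) <;>
      norm_num [sum_Ico_eq_sum_range, sum_range_succ, prod_range_succ, sieveBound,
        weightBound, nthPrimeOmitting]
  · apply key 2 3 (2111/5000) (2793/10000) <;>
      norm_num [sum_Ico_eq_sum_range, sum_range_succ, prod_range_succ, sieveBound,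
        weightBound, nthPrimeOmitting]
  · apply key 2 3 (4793/10000) (2793/10000) <;>
      norm_num [sum_Ico_eq_sum_range, sum_range_succ, prod_range_succ, sieveBound,
        weightBound, nthPrimeOmitting]
  · apply key 3 3 (3313/10000) (3313/10000) <;>
      norm_num [sum_Ico_eq_sum_range, sum_range_succ, prod_range_succ, sieveBound,
        weightBound, nthPrimeOmitting]
  · apply key 3 3 (3453/10000) (3453/10000) <;>
      norm_num [sum_Ico_eq_sum_range, sum_range_succ, prod_range_succ, sieveBound,
        weightBound, nthPrimeOmitting]
  · apply key 3 3 (1817/5000) (1817/5000) <;>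
      norm_num [sum_Ico_eq_sum_range, sum_range_succ, prod_range_succ, sieveBound,
        weightBound, nthPrimeOmitting]
  · apply key 3 3 (231/625) (231/625) <;>
      norm_num [sum_Ico_eq_sum_range, sum_range_succ, prod_range_succ, sieveBound,
        weightBound, nthPrimeOmitting]
  · apply key 2 3 (4657/10000) (807/2500) <;>
      norm_num [sum_Ico_eq_sum_range, sum_range_succ, prod_range_succ, sieveBound,
        weightBound, nthPrimeOmitting]
  · apply key 2 3 (4657/10000) (807/2500) <;>
      norm_num [sum_Ico_eq_sum_range, sum_range_succ, prod_range_succ, sieveBound,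
        weightBound, nthPrimeOmitting]
  · apply key 3 3 (807/2500) (807/2500) <;>
      norm_num [sum_Ico_eq_sum_range, sum_range_succ, prod_range_succ, sieveBound,
        weightBound, nthPrimeOmitting]
  · apply key 3 3 (937/2500) (937/2500) <;>
      norm_num [sum_Ico_eq_sum_range, sum_range_succ, prod_range_succ, sieveBound,
        weightBound, nthPrimeOmitting]
  · apply key 3 3 (3887/10000) (3887/10000) <;>
      norm_num [sum_Ico_eq_sum_range, sum_range_succ, prod_range_succ, sieveBound,
        weightBound, nthPrimeOmitting]
  · apply key 3 3 (1017/2500) (1017/2500) <;>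
      norm_num [sum_Ico_eq_sum_range, sum_range_succ, prod_range_succ, sieveBound,
        weightBound, nthPrimeOmitting]
  · apply key 3 3 (413/1000) (413/1000) <;>
      norm_num [sum_Ico_eq_sum_range, sum_range_succ, prod_range_succ, sieveBound,
        weightBound, nthPrimeOmitting]
  · apply key 3 4 (2111/5000) (2793/10000) <;>
      norm_num [sum_Ico_eq_sum_range, sum_range_succ, prod_range_succ, sieveBound,
        weightBound, nthPrimeOmitting]

/-- If `p - 1` has `k` prime factors, where `9 ≤ k ≤ 12`, the sieve succeeds once `p` is at least
the square of this number. -/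
def sieveBoundLarge (k : ℕ) : ℕ := [14409, 24045, 35928, 53992].getD (k - 9) 0

theorem hasCoprimeRoot_of_sieveBoundLarge_sq_le {p k : ℕ} (hp : p.Prime) (h5 : 5 ≤ p)
    (hk : #(p - 1).primeFactors = k) (hk₀ : 9 ≤ k) (hk₁ : k ≤ 12)
    (h : sieveBoundLarge k ^ 2 ≤ p) : HasCoprimeRoot p := by
  have key := hasCoprimeRoot_of_weightBound (m := Nat.nth Nat.Prime) hp h5 hk
    (fun L hL hmono i hi => nth_prime_le_of_strictMono (fun i hi => (hL i hi).1) hmono hi)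
    (fun _ => le_rfl) h
  clear hk h
  interval_cases k
  · apply key 3 4 (4657/10000) (807/2500) <;>
      norm_num [sum_Ico_eq_sum_range, sum_range_succ, prod_range_succ, sieveBoundLarge, weightBound]
  · apply key 4 4 (3573/10000) (3573/10000) <;>
      norm_num [sum_Ico_eq_sum_range, sum_range_succ, prod_range_succ, sieveBoundLarge, weightBound]
  · apply key 4 4 (487/1250) (487/1250) <;>
      norm_num [sum_Ico_eq_sum_range, sum_range_succ, prod_range_succ, sieveBoundLarge, weightBound]
  · apply key 4 4 (2083/5000) (2083/5000) <;>
      norm_num [sum_Ico_eq_sum_range, sum_range_succ, prod_range_succ, sieveBoundLarge, weightBound]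

theorem prod_nth_prime_lt {p : ℕ} (hp : 2 ≤ p) :
    ∏ i ∈ range #(p - 1).primeFactors, Nat.nth Nat.Prime i < p := by
  obtain ⟨L, hmono, hL⟩ := exists_sorted_enumeration (p - 1).primeFactors
  have hprime : ∀ i < #(p - 1).primeFactors, (L i).Prime := fun i hi =>
    Nat.prime_of_mem_primeFactors (hL ▸ mem_image_of_mem L (mem_range.2 hi))
  have hinj : Set.InjOn L (range #(p - 1).primeFactors) :=
    card_image_iff.1 (by rw [hL, card_range])
  calc ∏ i ∈ range #(p - 1).primeFactors, Nat.nth Nat.Prime i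
      ≤ ∏ i ∈ range #(p - 1).primeFactors, L i :=
        prod_le_prod (fun _ _ => Nat.zero_le _) fun i hi =>
          nth_prime_le_of_strictMono hprime hmono (mem_range.1 hi)
    _ = ∏ l ∈ (p - 1).primeFactors, l := by
        conv_rhs => rw [← hL]
        rw [prod_image hinj]
    _ ≤ p - 1 := Nat.le_of_dvd (by omega) (Nat.prod_primeFactors_dvd _)
    _ < p := by omega

theorem two_mul_add_five_le_nth_prime {i : ℕ} (hi : 6 ≤ i) : 2 * i + 5 ≤ Nat.nth Nat.Prime i := by
  induction i, hi using Nat.le_induction with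
  | base => rw [nth_prime_six_eq_seventeen]
  | succ i hi ih =>
    have hlt : Nat.nth Nat.Prime i < Nat.nth Nat.Prime (i + 1) :=
      Nat.nth_strictMono Nat.infinite_setOfPred_prime i.lt_succ_self
    have h1 := (Nat.prime_nth_prime i).eq_two_or_odd
    have h2 := (Nat.prime_nth_prime (i + 1)).eq_two_or_odd
    omega

theorem forty_one_le_nth_prime {i : ℕ} (hi : 12 ≤ i) : 41 ≤ Nat.nth Nat.Prime i :=
  (Nat.nth_count (by norm_num : Nat.Prime 41)).symm.le.trans
    (Nat.nth_monotone Nat.infinite_setOfPred_prime hi)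

theorem pow_forty_one_le_prod_nth_prime {k : ℕ} (hk : 12 ≤ k) :
    7420738134810 * 41 ^ (k - 12) ≤ ∏ i ∈ range k, Nat.nth Nat.Prime i := by
  obtain ⟨m, rfl⟩ := Nat.exists_eq_add_of_le hk
  rw [prod_range_add, Nat.add_sub_cancel_left]
  refine Nat.mul_le_mul (le_of_eq ?_) ?_
  · norm_num [prod_range_succ]
  · calc 41 ^ m = ∏ _i ∈ range m, 41 := by rw [prod_const, card_range]
      _ ≤ _ := prod_le_prod (fun _ _ => Nat.zero_le _) fun i _ =>
        forty_one_le_nth_prime (Nat.le_add_right 12 i)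

theorem five_pow_mul_lt_pow_forty_one (j : ℕ) :
    15625 * 5 ^ j * ((2 * j + 15) * (2 * j + 17)) + (2 * j + 17) * (j + 7) + 3 <
      4086150 * 41 ^ j := by
  induction j with
  | zero => norm_num
  | succ j ih =>
    have h1 : 5 * ((2 * (j + 1) + 15) * (2 * (j + 1) + 17)) ≤
        41 * ((2 * j + 15) * (2 * j + 17)) := by nlinarith
    have h2 := Nat.mul_le_mul_left (15625 * 5 ^ j) h1
    rw [pow_succ, pow_succ]
    nlinarith

theorem hasCoprimeRoot_of_thirteen_le {p : ℕ} (hp : p.Prime) (h5 : 5 ≤ p)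
    (hk : 13 ≤ #(p - 1).primeFactors) : HasCoprimeRoot p := by
  set k := #(p - 1).primeFactors with hkdef
  obtain ⟨j, hj⟩ : ∃ j, k / 2 = j + 6 := ⟨k / 2 - 6, by omega⟩
  have hkf : (k : ℝ) - (j + 6 : ℕ) ≤ j + 7 := by
    have : k ≤ (j + 6) + (j + 7) := by omega
    have : (k : ℝ) ≤ ((j + 6) + (j + 7) : ℕ) := Nat.cast_le.2 this
    push_cast at this ⊢
    linarith
  have hkf0 : (0 : ℝ) ≤ k - (j + 6 : ℕ) := sub_nonneg.2 (Nat.cast_le.2 (by omega))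
  have hτ : ∑ i ∈ Ico (j + 6) k, (Nat.nth Nat.Prime i : ℝ)⁻¹ ≤ (j + 7) / (2 * j + 17) := by
    have h17 : (0 : ℝ) < 2 * j + 17 := by positivity
    calc ∑ i ∈ Ico (j + 6) k, (Nat.nth Nat.Prime i : ℝ)⁻¹
        ≤ #(Ico (j + 6) k) • (2 * (j : ℝ) + 17)⁻¹ := by
          refine sum_le_card_nsmul _ _ _ fun i hi => ?_
          have hi := (mem_Ico.1 hi).1
          have h := two_mul_add_five_le_nth_prime (i := i) (by omega)
          have : ((2 * j + 17 : ℕ) : ℝ) ≤ Nat.nth Nat.Prime i := Nat.cast_le.2 (by omega)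
          push_cast at this
          gcongr
      _ = (k - (j + 6 : ℕ)) / (2 * j + 17) := by
          rw [nsmul_eq_mul, Nat.card_Ico, Nat.cast_sub (by omega), div_eq_mul_inv]
      _ ≤ _ := by gcongr
  have hr : (2724100 * 41 ^ j : ℝ) ^ 2 ≤ p := by
    have h1 := (pow_forty_one_le_prod_nth_prime (k := k) (by omega)).trans
      (prod_nth_prime_lt hp.two_le).le
    have h2 : (41 : ℕ) ^ (2 * j) ≤ 41 ^ (k - 12) := Nat.pow_le_pow_right (by norm_num) (by omega)
    have h3 : (2724100 * 41 ^ j) ^ 2 ≤ p := by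
      rw [mul_pow, ← pow_mul, mul_comm j]
      omega
    exact_mod_cast h3
  have hst : (j + 7 : ℝ) / (2 * j + 17) + (j + 7) / (2 * j + 17) < 1 := by
    rw [← add_div, div_lt_one (by positivity)]
    linarith
  refine hasCoprimeRoot_of_lt (e := j + 6) (f := j + 6) (m := Nat.nth Nat.Prime)
    (c := fun _ => 2 / 5) hp h5 hkdef.symm (by omega) (by omega) (by omega) (Or.inr (by omega))
    (fun i => (Nat.prime_nth_prime i).pos)
    (fun L hL hmono i hi => nth_prime_le_of_strictMono (fun i hi => (hL i hi).1) hmono hi)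
    (fun _ => by norm_num) (by norm_num)
    (fun i _ hi => ?_) hτ hτ hst hr ?_
  · have h3 : (3 : ℝ) ≤ Nat.nth Nat.Prime i := by
      have : Nat.nth Nat.Prime 1 ≤ Nat.nth Nat.Prime i :=
        Nat.nth_monotone Nat.infinite_setOfPred_prime hi
      rw [Nat.nth_prime_one_eq_three] at this
      exact_mod_cast this
    have : (Nat.nth Nat.Prime i : ℝ)⁻¹ ^ 2 ≤ (3 : ℝ)⁻¹ ^ 2 := by gcongr
    linarith
  · rw [prod_const, card_range]
    have hσ0 : (0 : ℝ) ≤ (j + 7) / (2 * j + 17) := by positivity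
    have hδ : 1 - (j + 7 : ℝ) / (2 * j + 17) - (j + 7) / (2 * j + 17) = 3 / (2 * j + 17) := by
      field_simp
      ring
    rw [hδ]
    have hmain : (15625 * 5 ^ j * ((2 * j + 15) * (2 * j + 17)) + (2 * j + 17) * (j + 7) + 3 : ℝ) <
        4086150 * 41 ^ j := by exact_mod_cast five_pow_mul_lt_pow_forty_one j
    have hE : (1 : ℝ) ≤ 2 ^ (j + 6) := one_le_pow₀ one_le_two
    calc _ ≤ (2 : ℝ) ^ (j + 6) * (2 * j + 15) := by
          generalize (2 : ℝ) ^ (j + 6) = E at *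
          generalize (j + 7 : ℝ) / (2 * j + 17) = x at *
          nlinarith [mul_nonneg hσ0 (sub_nonneg.2 hE),
            mul_nonneg (sub_nonneg.2 hkf) (zero_le_one.trans hE)]
      _ = (2 / 5 : ℝ) ^ (j + 6) * (15625 * 5 ^ j * (2 * j + 15)) := by
          rw [div_pow, pow_add 5]
          field_simp
          ring
      _ < _ := by
          refine mul_lt_mul_of_pos_left ?_ (by positivity)
          refine lt_of_lt_of_le ?_ (sub_le_sub_left hkf _)
          rw [lt_sub_iff_add_lt, mul_div_assoc', lt_div_iff₀ (by positivity)]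
          linarith

theorem hasCoprimeRoot_of_nine_le {p : ℕ} (hp : p.Prime) (h5 : 5 ≤ p)
    (hk : 9 ≤ #(p - 1).primeFactors) : HasCoprimeRoot p := by
  by_cases hk' : 13 ≤ #(p - 1).primeFactors
  · exact hasCoprimeRoot_of_thirteen_le hp h5 hk'
  refine hasCoprimeRoot_of_sieveBoundLarge_sq_le hp h5 rfl hk (by omega) ?_
  refine le_trans ?_ (prod_nth_prime_lt hp.two_le).le
  generalize #(p - 1).primeFactors = k at *
  interval_cases k <;> norm_num [prod_range_succ, sieveBoundLarge]

/-- The primes below 300. -/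
def smallPrimes : List ℕ :=
  [2, 3, 5, 7, 11, 13, 17, 19, 23, 29, 31, 37, 41, 43, 47, 53, 59, 61, 67, 71, 73, 79, 83, 89, 97,
    101, 103, 107, 109, 113, 127, 131, 137, 139, 149, 151, 157, 163, 167, 173, 179, 181, 191, 193,
    197, 199, 211, 223, 227, 229, 233, 239, 241, 251, 257, 263, 269, 271, 277, 281, 283, 293]

/-- The product of `smallPrimes`. -/
def smallProd : ℕ :=
  2043779758005154482257388030892804056228591188672553240869361360495290305558100337270153956915591354354320728837959427210

theorem prod_smallPrimes : smallPrimes.prod = smallProd := by decide +kernel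

theorem prime_of_mem_smallPrimes {l : ℕ} (hl : l ∈ smallPrimes) : l.Prime := by
  have : ∀ l ∈ smallPrimes, l.Prime := by simp only [smallPrimes]; norm_num
  exact this l hl

theorem dvd_smallProd_iff {l : ℕ} (hl : l.Prime) : l ∣ smallProd ↔ l ∈ smallPrimes := by
  rw [← prod_smallPrimes, hl.prime.dvd_prod_iff]
  constructor
  · rintro ⟨a, ha, hla⟩
    rwa [(Nat.prime_dvd_prime_iff_eq hl (prime_of_mem_smallPrimes ha)).1 hla]
  · exact fun h => ⟨l, h, dvd_rfl⟩

/-! The following functions are written with recursors and evaluated by the kernel. -/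

/-- `cond`, by a single recursor. -/
noncomputable def select (c t e : Bool) : Bool :=
  Bool.rec e t c

@[simp] theorem select_eq (c t e : Bool) : select c t e = cond c t e := by cases c <;> rfl

/-- Apply `f` to `n` after evaluating `n`. -/
noncomputable def force (n : ℕ) (f : ℕ → Bool) : Bool :=
  Nat.rec (f 0) (fun m _ => f (Nat.succ m)) n

@[simp] theorem force_eq (n : ℕ) (f : ℕ → Bool) : force n f = f n := by cases n <;> rfl

/-- Whether `f` holds for all elements of `l`. -/
noncomputable def all (f : ℕ → Bool) (l : List ℕ) : Bool :=
  List.rec true (fun a _ ih => select ih (f a) false) l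

theorem all_eq_true {f : ℕ → Bool} {l : List ℕ} (h : all f l = true) : ∀ a ∈ l, f a = true := by
  induction l with
  | nil => simp
  | cons a l ih =>
    change select (all f l) (f a) false = true at h
    cases hfa : all f l <;> simp_all

/-- Whether `f` holds for some element of `l`. -/
noncomputable def any (f : ℕ → Bool) (l : List ℕ) : Bool :=
  List.rec false (fun a _ ih => select (f a) true ih) l

theorem any_eq_true {f : ℕ → Bool} {l : List ℕ} (h : any f l = true) : ∃ a ∈ l, f a = true := by
  induction l with
  | nil => exact absurd h Bool.false_ne_true
  | cons a l ih =>
    change select (f a) true (any f l) = true at h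
    cases hfa : f a <;> simp_all

/-- Whether `g ^ e` is not `1` modulo `p`, given residues `h₁` of `g ^ 256` and `h₂` of
`h₁ ^ 256`. -/
noncomputable def powNeOne (p g h₁ h₂ e : ℕ) : Bool :=
  select (Nat.beq 1 (Nat.mod (Nat.mul (Nat.mul (Nat.pow g (Nat.mod e 256))
    (Nat.pow h₁ (Nat.mod (Nat.div e 256) 256))) (Nat.pow h₂ (Nat.div e 65536))) p)) false true

theorem pow_ne_one_of_powNeOne {p g e : ℕ} (hp : 1 < p)
    (h : powNeOne p g (g ^ 256 % p) ((g ^ 256 % p) ^ 256 % p) e = true) :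
    (g : ZMod p) ^ e ≠ 1 := by
  intro he
  have he' : e = e % 256 + (256 * (e / 256 % 256) + 256 * 256 * (e / 65536)) := by omega
  rw [he', pow_add, pow_add, pow_mul, pow_mul, pow_mul] at he
  have h' : g ^ (e % 256) * (g ^ 256 % p) ^ (e / 256 % 256) *
      ((g ^ 256 % p) ^ 256 % p) ^ (e / 65536) % p = 1 := by
    rw [← Nat.mod_eq_of_lt hp]
    refine (ZMod.natCast_eq_natCast_iff' _ _ _).1 ?_
    push_cast
    simp only [ZMod.natCast_mod, Nat.cast_pow]
    rw [mul_assoc]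
    exact he
  change select (Nat.beq 1 (g ^ (e % 256) * (g ^ 256 % p) ^ (e / 256 % 256) *
      ((g ^ 256 % p) ^ 256 % p) ^ (e / 65536) % p)) false true = true at h
  rw [h'] at h
  exact absurd h Bool.false_ne_true

/-- Search for a small prime `g ≤ q` coprime to `q` with `g ^ (q / l) ≠ 1` modulo `p` for all `l`
in `ls`. -/
noncomputable def rootTest (p q : ℕ) (ls : List ℕ) : Bool :=
  any (fun g => force g fun g => select (Nat.beq (Nat.gcd g q) 1) (select (Nat.ble g q)
    (force (Nat.mod (Nat.pow g 256) p) fun h₁ => force (Nat.mod (Nat.pow h₁ 256) p) fun h₂ =>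
      all (fun l => force (Nat.div q l) (powNeOne p g h₁ h₂)) ls) false) false) smallPrimes

theorem hasCoprimeRoot_of_rootTest {q : ℕ} {ls : List ℕ} (hq : 0 < q)
    (hls : ∀ l, l.Prime → l ∣ q → l ∈ ls) (h : rootTest (q + 1) q ls = true) :
    HasCoprimeRoot (q + 1) := by
  obtain ⟨g, -, hg⟩ := any_eq_true h
  simp only [force_eq, select_eq, Bool.cond_false_right, Bool.and_eq_true] at hg
  obtain ⟨hg₁, hg₂, hg₃⟩ := hg
  refine ⟨g, Nat.lt_succ_of_le (Nat.le_of_ble_eq_true hg₂), Nat.eq_of_beq_eq_true hg₁,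
    fun l hl hlq => ?_⟩
  exact pow_ne_one_of_powNeOne (by omega) (all_eq_true hg₃ l (hls l hl hlq))

/-- Whether `q + 1` is at most `4`, or has a prime factor below `300` without being such a prime, or
fails a Fermat test, or passes `rootTest`. -/
noncomputable def check (q : ℕ) (ls : List ℕ) : Bool :=
  force (Nat.succ q) fun p =>
    select (select (Nat.ble p 293) (Nat.ble 5 p) (Nat.beq (Nat.gcd p smallProd) 1))
      (force (Nat.mod (Nat.pow 2 256) p) fun h₁ => force (Nat.mod (Nat.pow h₁ 256) p) fun h₂ =>
        select (powNeOne p 2 h₁ h₂ q) true (rootTest p q ls)) true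

theorem hasCoprimeRoot_of_check {q : ℕ} {ls : List ℕ} (hp : (q + 1).Prime) (hq : 4 ≤ q)
    (hls : ∀ l, l.Prime → l ∣ q → l ∈ ls) (h : check q ls = true) : HasCoprimeRoot (q + 1) := by
  have hcop : select (Nat.ble (q + 1) 293) (Nat.ble 5 (q + 1))
      (Nat.beq (Nat.gcd (q + 1) smallProd) 1) = true := by
    simp only [select_eq, Bool.cond_eq_ite, Nat.ble_eq]
    split_ifs with h293
    · exact Nat.ble_eq_true_of_le (by omega)
    · refine Nat.beq_eq ▸ ((hp.coprime_iff_not_dvd).2 fun hdvd => h293 ?_)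
      have hle : ∀ l ∈ smallPrimes, l ≤ 293 := by decide +kernel
      exact hle _ ((dvd_smallProd_iff hp).1 hdvd)
  have hfermat : powNeOne (q + 1) 2 (2 ^ 256 % (q + 1)) ((2 ^ 256 % (q + 1)) ^ 256 % (q + 1)) q =
      false := by
    rw [← Bool.not_eq_true]
    intro hne
    refine pow_ne_one_of_powNeOne (by omega) hne ?_
    have := Fact.mk hp
    have h2 : ((2 : ℕ) : ZMod (q + 1)) ≠ 0 := by
      rw [Ne, ZMod.natCast_eq_zero_iff]
      exact fun hdvd => by have := Nat.le_of_dvd two_pos hdvd; omega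
    simpa using ZMod.pow_card_sub_one_eq_one h2
  change force (q + 1) (fun p => _) = true at h
  rw [force_eq, hcop, select_eq, Bool.cond_true, force_eq, force_eq] at h
  change select (powNeOne (q + 1) 2 (2 ^ 256 % (q + 1)) ((2 ^ 256 % (q + 1)) ^ 256 % (q + 1)) q)
    true (rootTest (q + 1) q ls) = true at h
  rw [hfermat] at h
  exact hasCoprimeRoot_of_rootTest (by omega) hls h

/-- Whether `f` holds at `a`, `a + s`, …, `a + (2 ^ D - 1) * s`, ignoring the terms `x` such that
`N ≤ c * x ^ e`. -/
noncomputable def scan (N c e s : ℕ) (f : ℕ → Bool) (D : ℕ) : ℕ → Bool :=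
  Nat.rec (fun a => select (Nat.ble N (Nat.mul c (Nat.pow a e))) true (f a))
    (fun D ih a => select (Nat.ble N (Nat.mul c (Nat.pow a e))) true
      (select (ih a) (force (Nat.add a (Nat.mul s (Nat.pow 2 D))) ih) false)) D

theorem scan_eq_true {N c e s : ℕ} {f : ℕ → Bool} {D a : ℕ} (h : scan N c e s f D a = true)
    {i : ℕ} (hi : i < 2 ^ D) (hN : c * (a + s * i) ^ e < N) : f (a + s * i) = true := by
  have hcut : Nat.ble N (c * a ^ e) = false := by
    rw [← Bool.not_eq_true, Nat.ble_eq, not_le]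
    exact (Nat.mul_le_mul_left _ (Nat.pow_le_pow_left (Nat.le_add_right _ _) _)).trans_lt hN
  induction D generalizing a i with
  | zero =>
    obtain rfl : i = 0 := by omega
    change select (Nat.ble N (c * a ^ e)) true (f a) = true at h
    rw [hcut, select_eq] at h
    exact h
  | succ D ih =>
    change select (Nat.ble N (c * a ^ e)) true (select (scan N c e s f D a)
      (force (a + s * 2 ^ D) (scan N c e s f D)) false) = true at h
    rw [hcut, force_eq, select_eq, select_eq, Bool.cond_false_right] at h
    simp only [Bool.cond_false, Bool.and_eq_true] at h
    by_cases hi' : i < 2 ^ D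
    · exact ih h.1 hi' hN hcut
    · obtain ⟨j, rfl⟩ := Nat.exists_eq_add_of_le (not_lt.1 hi')
      rw [mul_add, ← add_assoc] at hN ⊢
      refine ih h.2 (by rw [pow_succ] at hi; omega) hN ?_
      rw [← Bool.not_eq_true, Nat.ble_eq, not_le]
      exact (Nat.mul_le_mul_left _ (Nat.pow_le_pow_left (Nat.le_add_right _ _) _)).trans_lt hN

/-- Whether `f` holds at `x`, `x * l`, …, `x * l ^ D`, ignoring the terms that are at least `N`,
except possibly the last one. -/
noncomputable def scanPow (N l : ℕ) (f : ℕ → Bool) (D : ℕ) : ℕ → Bool :=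
  Nat.rec f (fun _ ih x => select (Nat.ble N x) true
    (select (f x) (force (Nat.mul x l) ih) false)) D

theorem scanPow_eq_true {N l : ℕ} {f : ℕ → Bool} {D x a : ℕ} (h : scanPow N l f D x = true)
    (hl : 0 < l) (ha : a ≤ D) (hN : x * l ^ a < N) : f (x * l ^ a) = true := by
  induction D generalizing x a with
  | zero =>
    obtain rfl := Nat.le_zero.1 ha
    rwa [pow_zero, mul_one]
  | succ D ih =>
    have hcut : Nat.ble N x = false := by
      rw [← Bool.not_eq_true, Nat.ble_eq, not_le]
      exact (Nat.le_mul_of_pos_right x (pow_pos hl a)).trans_lt hN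
    change select (Nat.ble N x) true (select (f x) (force (x * l) (scanPow N l f D)) false) =
      true at h
    rw [hcut, force_eq, select_eq, select_eq, Bool.cond_false_right, Bool.cond_false,
      Bool.and_eq_true] at h
    rcases a with _ | a
    · rw [pow_zero, mul_one]
      exact h.1
    · rw [pow_succ', ← mul_assoc] at hN ⊢
      exact ih h.2 (by omega) hN

theorem exists_eq_pow_succ_mul {q m : ℕ} (hq : q.Prime) (hqm : q ∣ m) (hm : m ≠ 0) :
    ∃ a m', m = q ^ (a + 1) * m' ∧ m'.primeFactors = m.primeFactors.erase q := by
  obtain ⟨a, m', hqm', rfl⟩ := Nat.exists_eq_pow_mul_and_not_dvd hm q hq.ne_one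
  rcases a with _ | a
  · rw [pow_zero, one_mul] at hqm
    exact absurd hqm hqm'
  · refine ⟨a, m', rfl, ?_⟩
    have hm' : m' ≠ 0 := right_ne_zero_of_mul hm
    rw [Nat.primeFactors_mul (pow_ne_zero _ hq.ne_zero) hm',
      Nat.primeFactors_prime_pow a.succ_ne_zero hq, ← insert_eq, erase_insert]
    exact fun h => hqm' (Nat.dvd_of_mem_primeFactors h)

theorem le_of_mul_pow_lt {d q a b N D : ℕ} (hq : 2 ≤ q) (h : d * q ^ a * b < N) (hd : 0 < d)
    (hb : 0 < b) (hND : N ≤ 2 ^ D) : a ≤ D := by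
  have h1 : 2 ^ a ≤ d * q ^ a * b :=
    (Nat.pow_le_pow_left hq a).trans
      ((Nat.le_mul_of_pos_left _ hd).trans (Nat.le_mul_of_pos_right _ hb))
  exact ((Nat.pow_lt_pow_iff_right one_lt_two).1 (h1.trans_lt (h.trans_le hND))).le

theorem mem_cons_of_dvd_mul_pow {d q a : ℕ} {ls : List ℕ} (hq : q.Prime)
    (hls : ∀ x, x.Prime → x ∣ d → x ∈ ls) {x : ℕ} (hx : x.Prime) (h : x ∣ d * q ^ a) :
    x ∈ q :: ls := by
  rcases hx.dvd_mul.1 h with h | h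
  · exact List.mem_cons_of_mem _ (hls x hx h)
  · exact List.mem_cons.2 (Or.inl ((Nat.prime_dvd_prime_iff_eq hx hq).1 (hx.dvd_of_dvd_pow h)))

theorem gcd_take_smallPrimes_eq_one {q i c b : ℕ} (hq : q.Prime)
    (hc : (smallPrimes.take i).prod = 2 * c) (hb : ∀ x ∈ smallPrimes.take i, x ≤ b) (hbq : b < q) :
    Nat.gcd q c = 1 := by
  refine (hq.coprime_iff_not_dvd).2 fun hdvd => ?_
  obtain ⟨x, hx, hqx⟩ := (hq.prime.dvd_prod_iff).1 (hc ▸ hdvd.mul_left 2)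
  have := Nat.le_of_dvd (prime_of_mem_smallPrimes (List.mem_of_mem_take hx)).pos hqx
  exact absurd (hb x hx) (by omega)

/-- Run `check` on all `d * m < N` such that `m` has exactly `k` prime factors, all of them odd and
at least the odd number `l`. The prime factors of `d` are listed in `ls`. -/
noncomputable def enum (N D k : ℕ) : ℕ → List ℕ → ℕ → Bool :=
  Nat.rec (fun d ls _ => check d ls)
    (fun k ih d ls l => scan N d (Nat.succ k) 2 (fun l =>
      select (select (Nat.ble l 79) (select (Nat.ble l 17) true (Nat.beq (Nat.gcd l 255255) 1))
          (Nat.beq (Nat.gcd l 1608822383670336453949542277065) 1))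
        (force (Nat.add l 2) fun l' => force (Nat.mul d l) fun d' =>
          scanPow N l (fun x => ih x (l :: ls) l') D d') true) D l) k

theorem hasCoprimeRoot_of_enum {N D k d l m : ℕ} {ls : List ℕ} (h : enum N D k d ls l = true)
    (hND : N ≤ 2 ^ D) (hl : Odd l) (hm : ∀ x ∈ m.primeFactors, Odd x ∧ l ≤ x)
    (hk : #m.primeFactors = k) (hls : ∀ x, x.Prime → x ∣ d → x ∈ ls) (h4 : 4 ≤ d * m)
    (hN : d * m < N) (hp : (d * m + 1).Prime) : HasCoprimeRoot (d * m + 1) := by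
  have hm0 : m ≠ 0 := right_ne_zero_of_mul (a := d) (by omega)
  have hd0 : 0 < d := Nat.pos_of_ne_zero (left_ne_zero_of_mul (b := m) (by omega))
  induction k generalizing d ls l m with
  | zero =>
    obtain rfl := (Nat.primeFactors_eq_empty.1 (card_eq_zero.1 hk)).resolve_left hm0
    rw [mul_one] at *
    exact hasCoprimeRoot_of_check hp h4 hls h
  | succ k ih =>
    have hm1 : m ≠ 1 := fun h => by simp [h] at hk
    have hq := Nat.minFac_prime hm1
    obtain ⟨hqo, hlq⟩ := hm m.minFac (Nat.mem_primeFactors.2 ⟨hq, m.minFac_dvd, hm0⟩)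
    have hmin : ∀ x ∈ m.primeFactors, m.minFac ≤ x := fun x hx =>
      Nat.minFac_le_of_dvd (Nat.prime_of_mem_primeFactors hx).two_le
        (Nat.dvd_of_mem_primeFactors hx)
    obtain ⟨a, m', hmm', hm'⟩ := exists_eq_pow_succ_mul hq m.minFac_dvd hm0
    have hqm : m.minFac ^ (k + 1) ≤ m := by
      rw [← hk]
      exact (pow_card_le_prod _ _ _ hmin).trans
        (Nat.le_of_dvd (Nat.pos_of_ne_zero hm0) (Nat.prod_primeFactors_dvd m))
    have hdq : d * m.minFac ^ (k + 1) < N := (Nat.mul_le_mul_left d hqm).trans_lt hN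
    have hk' : #m'.primeFactors = k := by
      rw [hm', card_erase_of_mem (Nat.mem_primeFactors.2 ⟨hq, m.minFac_dvd, hm0⟩), hk,
        Nat.add_sub_cancel]
    generalize m.minFac = q at *
    subst hmm'
    have hm'0 : m' ≠ 0 := right_ne_zero_of_mul hm0
    obtain ⟨i, rfl⟩ : ∃ i, q = l + 2 * i := by
      obtain ⟨a, ha⟩ := hqo
      obtain ⟨b, hb⟩ := hl
      exact ⟨a - b, by omega⟩
    have hf := scan_eq_true (f := fun l =>
      select (select (Nat.ble l 79) (select (Nat.ble l 17) true (Nat.beq (Nat.gcd l 255255) 1))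
          (Nat.beq (Nat.gcd l 1608822383670336453949542277065) 1))
        (force (Nat.add l 2) fun l' => force (Nat.mul d l) fun d' =>
          scanPow N l (fun x => enum N D k x (l :: ls) l') D d') true) h (i := i)
      (by
        have : l + 2 * i ≤ d * (l + 2 * i) ^ (k + 1) :=
          (Nat.le_self_pow k.succ_ne_zero _).trans (Nat.le_mul_of_pos_left _ hd0)
        omega) hdq
    have htest : select (Nat.ble (l + 2 * i) 79)
        (select (Nat.ble (l + 2 * i) 17) true (Nat.beq (Nat.gcd (l + 2 * i) 255255) 1))
        (Nat.beq (Nat.gcd (l + 2 * i) 1608822383670336453949542277065) 1) = true := by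
      simp only [select_eq, Bool.cond_eq_ite, Nat.ble_eq]
      split_ifs with h79 h17
      · rfl
      · rw [Nat.beq_eq]
        refine gcd_take_smallPrimes_eq_one (i := 7) hq (by decide +kernel) ?_ (not_le.1 h17)
        decide +kernel
      · rw [Nat.beq_eq]
        refine gcd_take_smallPrimes_eq_one (i := 22) hq (by decide +kernel) ?_ (not_le.1 h79)
        decide +kernel
    generalize l + 2 * i = q at *
    rw [htest, select_eq, Bool.cond_true, force_eq, force_eq] at hf
    have heq : d * (q ^ (a + 1) * m') = d * q ^ (a + 1) * m' := by ring
    have hpow : d * q * q ^ a = d * q ^ (a + 1) := by ring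
    rw [heq] at h4 hN hp ⊢
    have hf' := scanPow_eq_true hf hq.pos (a := a) ?_ ?_
    · refine ih (l := q + 2) (ls := q :: ls) ?_ ?_ (fun x hx => ?_) hk' ?_ h4 hN hp hm'0
        (Nat.mul_pos hd0 (pow_pos hq.pos _))
      · exact hpow ▸ hf'
      · obtain ⟨b, hb⟩ := hqo
        exact ⟨b + 1, by omega⟩
      · rw [hm'] at hx
        obtain ⟨hxo, -⟩ := hm x (mem_of_mem_erase hx)
        have h1 := hmin x (mem_of_mem_erase hx)
        have h2 := ne_of_mem_erase hx
        refine ⟨hxo, ?_⟩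
        obtain ⟨b, hb⟩ := hqo
        obtain ⟨c, hc⟩ := hxo
        omega
      · exact fun x hx => mem_cons_of_dvd_mul_pow hq hls hx
    · exact (Nat.le_succ a).trans (le_of_mul_pow_lt hq.two_le hN hd0 (Nat.pos_of_ne_zero hm'0) hND)
    · rw [Nat.mul_eq, hpow]
      exact (Nat.le_mul_of_pos_right _ (Nat.pos_of_ne_zero hm'0)).trans_lt hN

/-- Multiply `d` by a positive power of each element of `ps` in all ways that give numbers below
`N`, add the elements of `ps` to `ls`, and apply `f`. -/
noncomputable def extendScan (N D : ℕ) (f : ℕ → List ℕ → Bool) (ps : List ℕ) :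
    ℕ → List ℕ → Bool :=
  List.rec f (fun a _ ih d ls => force (Nat.mul d a) fun d' =>
    scanPow N a (fun x => ih x (a :: ls)) D d') ps

theorem exists_of_extendScan {N D d m : ℕ} {f : ℕ → List ℕ → Bool} {ps ls : List ℕ}
    (h : extendScan N D f ps d ls = true) (hND : N ≤ 2 ^ D) (hps : ps.Nodup)
    (hpm : ∀ a ∈ ps, a ∈ m.primeFactors) (hls : ∀ x, x.Prime → x ∣ d → x ∈ ls) (hd : 0 < d)
    (hm : m ≠ 0) (hN : d * m < N) :
    ∃ d' m' ls', d' * m' = d * m ∧ f d' ls' = true ∧ (∀ x, x.Prime → x ∣ d' → x ∈ ls') ∧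
      m'.primeFactors = m.primeFactors \ ps.toFinset := by
  induction ps generalizing d m ls with
  | nil => exact ⟨d, m, ls, rfl, h, hls, by simp⟩
  | cons q ps ih =>
    obtain ⟨hqps, hps⟩ := List.nodup_cons.1 hps
    obtain ⟨hq, hqm, -⟩ := Nat.mem_primeFactors.1 (hpm q List.mem_cons_self)
    obtain ⟨a, m', rfl, hm'⟩ := exists_eq_pow_succ_mul hq hqm hm
    have hm'0 : m' ≠ 0 := right_ne_zero_of_mul hm
    have heq : d * (q ^ (a + 1) * m') = d * q ^ (a + 1) * m' := by ring
    have hpow : d * q * q ^ a = d * q ^ (a + 1) := by ring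
    rw [heq] at hN
    change force (d * q) (fun d' => scanPow N q (fun x => extendScan N D f ps x (q :: ls)) D d') =
      true at h
    rw [force_eq] at h
    have hf := scanPow_eq_true h hq.pos (a := a)
      ((Nat.le_succ a).trans (le_of_mul_pow_lt hq.two_le hN hd (Nat.pos_of_ne_zero hm'0) hND))
      (hpow ▸ (Nat.le_mul_of_pos_right _ (Nat.pos_of_ne_zero hm'0)).trans_lt hN)
    rw [hpow] at hf
    obtain ⟨d', m'', ls', h1, h2, h3, h4⟩ := ih hf hps (fun b hb => by
      rw [hm']
      exact mem_erase.2 ⟨fun h => hqps (h ▸ hb), hpm b (List.mem_cons_of_mem _ hb)⟩)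
      (fun x hx => mem_cons_of_dvd_mul_pow hq hls hx) (Nat.mul_pos hd (pow_pos hq.pos _)) hm'0 hN
    refine ⟨d', m'', ls', heq ▸ h1, h2, h3, ?_⟩
    rw [h4, hm', List.toFinset_cons, sdiff_insert, erase_sdiff_comm]

/-- Run `check` on all `n < sieveBound k j ^ 2` with exactly `k` prime factors whose least prime
nondivisor is the one with index `j`. -/
noncomputable def classCheck (k j : ℕ) : Bool :=
  force (sieveBound k j ^ 2) fun N => force (Nat.succ (Nat.log2 N)) fun D =>
    force (k - j) fun i => force (smallPrimes.getD (j + 1) 0) fun l =>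
      extendScan N D (fun d ls => enum N D i d ls l) (smallPrimes.take j) 1 []

set_option maxRecDepth 100000 in
theorem classCheck_eq_true : ∀ k ≤ 8, ∀ j ≤ k, 0 < j → classCheck k j = true := by decide +kernel

theorem getD_smallPrimes {i : ℕ} (hi : i ≤ 9) : smallPrimes.getD i 0 = Nat.nth Nat.Prime i := by
  interval_cases i <;> simp [smallPrimes]

theorem take_smallPrimes {j : ℕ} (hj : j ≤ 8) :
    smallPrimes.take j = (List.range j).map (Nat.nth Nat.Prime) := by
  refine List.ext_getElem ?_ fun i hi _ => ?_
  · have : smallPrimes.length = 62 := rfl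
    rw [List.length_take, List.length_map, List.length_range]
    omega
  · simp only [List.length_take, lt_inf_iff] at hi
    rw [List.getElem_take, List.getElem_map, List.getElem_range, ← getD_smallPrimes (by omega),
      List.getD_eq_getElem _ _ hi.2]

theorem hasCoprimeRoot_of_lt_sieveBound_sq {p k j : ℕ} (hp : p.Prime) (h5 : 5 ≤ p)
    (hk : #(p - 1).primeFactors = k) (hj : ¬ Nat.nth Nat.Prime j ∣ p - 1)
    (hj' : ∀ i < j, Nat.nth Nat.Prime i ∣ p - 1) (hj₀ : 0 < j)
    (hjk : j ≤ k) (hk₈ : k ≤ 8) (h : p < sieveBound k j ^ 2) : HasCoprimeRoot p := by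
  have hcheck := classCheck_eq_true k hk₈ j hjk hj₀
  rw [classCheck, force_eq, force_eq, force_eq, force_eq, getD_smallPrimes (by omega),
    take_smallPrimes (hjk.trans hk₈)] at hcheck
  have hND : sieveBound k j ^ 2 ≤ 2 ^ (Nat.log2 (sieveBound k j ^ 2)).succ := Nat.lt_log2_self.le
  have hset : ((List.range j).map (Nat.nth Nat.Prime)).toFinset =
      (range j).image (Nat.nth Nat.Prime) := by
    ext; simp
  have hinj := Nat.nth_injective Nat.infinite_setOfPred_prime
  have hmem : ∀ i < j, Nat.nth Nat.Prime i ∈ (p - 1).primeFactors := fun i hi =>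
    Nat.mem_primeFactors.2 ⟨Nat.prime_nth_prime i, hj' i hi, by omega⟩
  obtain ⟨d, m, ls, hdm, hf, hls, hm⟩ := exists_of_extendScan (m := p - 1) hcheck hND
    (List.nodup_range.map hinj)
    (fun a ha => by
      obtain ⟨i, hi, rfl⟩ := List.mem_map.1 ha
      exact hmem i (List.mem_range.1 hi))
    (fun x hx h => absurd (Nat.dvd_one.1 h) hx.ne_one) one_pos (by omega) (by omega)
  rw [one_mul] at hdm
  have hp1 : p = d * m + 1 := by omega
  rw [hset] at hm
  have hcard : #m.primeFactors = k - j := by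
    rw [hm, card_sdiff_of_subset, hk, card_image_of_injective _ hinj, card_range]
    exact image_subset_iff.2 fun i hi => hmem i (mem_range.1 hi)
  have hodd : ∀ i, 0 < i → Odd (Nat.nth Nat.Prime i) := fun i hi =>
    (Nat.prime_nth_prime i).odd_of_ne_two fun h =>
      hi.ne' (hinj (h.trans Nat.nth_prime_zero_eq_two.symm))
  rw [hp1]
  refine hasCoprimeRoot_of_enum hf hND (hodd _ j.succ_pos) (fun x hx => ?_) hcard hls (by omega)
    (by omega) (by rwa [← hp1])
  rw [hm, mem_sdiff] at hx
  obtain ⟨hx, hxj⟩ := hx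
  have hxp := Nat.prime_of_mem_primeFactors hx
  obtain ⟨i, rfl⟩ : ∃ i, Nat.nth Nat.Prime i = x := ⟨_, Nat.nth_count hxp⟩
  have hij : j < i := by
    by_contra! hij
    rcases hij.lt_or_eq with hij | rfl
    · exact hxj (mem_image_of_mem _ (mem_range.2 hij))
    · exact hj (Nat.dvd_of_mem_primeFactors hx)
  exact ⟨hodd i (by omega), Nat.nth_monotone Nat.infinite_setOfPred_prime hij⟩

theorem hasCoprimeRoot {p : ℕ} (hp : p.Prime) (h5 : 5 ≤ p) : HasCoprimeRoot p := by
  by_cases hk : 9 ≤ #(p - 1).primeFactors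
  · exact hasCoprimeRoot_of_nine_le hp h5 hk
  have hinj := Nat.nth_injective Nat.infinite_setOfPred_prime
  have hsub : ∀ j, (∀ i < j, Nat.nth Nat.Prime i ∣ p - 1) → j ≤ #(p - 1).primeFactors := by
    intro j hj
    calc j = #((range j).image (Nat.nth Nat.Prime)) := by
          rw [card_image_of_injective _ hinj, card_range]
      _ ≤ _ := card_le_card <| image_subset_iff.2 fun i hi =>
        Nat.mem_primeFactors.2 ⟨Nat.prime_nth_prime i, hj i (mem_range.1 hi), by omega⟩
  have hex : ∃ j, ¬ Nat.nth Nat.Prime j ∣ p - 1 := by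
    by_contra! hall
    exact hk (hsub 9 fun i _ => hall i)
  classical
  have hj := Nat.find_spec hex
  have hj' : ∀ i < Nat.find hex, Nat.nth Nat.Prime i ∣ p - 1 := fun i hi =>
    not_not.1 (Nat.find_min hex hi)
  have hj₀ : 0 < Nat.find hex := by
    rw [Nat.find_pos, Nat.nth_prime_zero_eq_two, not_not]
    have := hp.eq_two_or_odd
    omega
  rcases le_or_gt (sieveBound #(p - 1).primeFactors (Nat.find hex) ^ 2) p with h | h
  · exact hasCoprimeRoot_of_sieveBound_sq_le hp h5 rfl hj hj₀ (hsub _ hj') (by omega) h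
  · exact hasCoprimeRoot_of_lt_sieveBound_sq hp h5 rfl hj hj' hj₀ (hsub _ hj') (by omega) h

theorem isPrimitiveRootModP_of_forall_pow_ne_one {p g : ℕ} (hp : p.Prime) (hg₀ : 0 < g)
    (hgp : g < p) (hg : ∀ l, l.Prime → l ∣ p - 1 → (g : ZMod p) ^ ((p - 1) / l) ≠ 1) :
    IsPrimitiveRootModP p g := by
  have := Fact.mk hp
  intro a ha
  have hg0 : (g : ZMod p) ≠ 0 := by
    rw [Ne, ZMod.natCast_eq_zero_iff]
    exact fun h => absurd (Nat.le_of_dvd hg₀ h) (not_le.2 hgp)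
  have hord : orderOf (Units.mk0 (g : ZMod p) hg0) = Nat.card (ZMod p)ˣ := by
    rw [Nat.card_eq_fintype_card, ZMod.card_units, ← orderOf_units, Units.val_mk0]
    exact orderOf_eq_of_pow_and_pow_div_prime (by have := hp.two_le; omega)
      (ZMod.pow_card_sub_one_eq_one hg0) hg
  have htop : Subgroup.zpowers (Units.mk0 (g : ZMod p) hg0) = ⊤ :=
    Subgroup.eq_top_of_card_eq _ (by rw [Nat.card_zpowers, hord])
  obtain ⟨k, hk⟩ := mem_powers_iff_mem_zpowers.2 (htop ▸ Subgroup.mem_top (Units.mk0 a ha))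
  refine ⟨k, ?_⟩
  simpa using congrArg Units.val hk

end Brizolis

theorem stmt0 (p : ℕ) (hp : p.Prime) (h5 : 5 ≤ p) :
    ∃ g : ℤ, 1 ≤ g ∧ g ≤ (p : ℤ) - 1 ∧ IsPrimitiveRootModP p g ∧
      Int.gcd g ((p : ℤ) - 1) = 1 := by
  obtain ⟨g, hgp, hcop, hg⟩ := Brizolis.hasCoprimeRoot hp h5
  have hg₀ : 0 < g := Nat.pos_of_ne_zero fun h => by
    rw [h, Nat.coprime_zero_left] at hcop
    omega
  refine ⟨g, by omega, by omega, ?_, ?_⟩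
  · exact Brizolis.isPrimitiveRootModP_of_forall_pow_ne_one hp hg₀ hgp hg
  · rw [← Nat.cast_pred hp.pos, Int.gcd_natCast_natCast]
    exact hcop
end

section
/- Let q ≥ 1 be an integer and let ε be a real number with 1/11 ≤ ε < 1/2. Let p be a prime satisfying p ≡ 1 (mod q), log log p > (log 6.83)/(1/2 − ε), and φ(p−1)/(p−1) ≤ 1/2 − ε, where φ is Euler's totient function. Then there exists an integer g with 1 < g < p−1 and gcd(g, (p−1)/q) = 1 such that g is a QNRNP modulo p. -/
/-- `g` is a quadratic non-residue modulo `p` which is not a primitive root modulo `p`. -/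
def IsQNRNP (p : ℕ) (g : ℤ) : Prop :=
  (¬ ∃ x : ℤ, x ^ 2 ≡ g [ZMOD p]) ∧ ¬ IsPrimitiveRootModP p g

section

open Finset

theorem MulChar.sum_add_mul_inv_add {F : Type*} [Field F] [Fintype F] {χ : MulChar F ℂ}
    [DecidableEq F] (hχ : χ ≠ 1) (b c : F) :
    ∑ a, χ (a + b) * χ⁻¹ (a + c) = if b = c then (Fintype.card F : ℂ) - 1 else -1 := by
  split_ifs with h
  · subst h
    rw [Fintype.sum_equiv (Equiv.addRight b) (fun a => χ (a + b) * χ⁻¹ (a + b))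
      (fun x => χ x * χ⁻¹ x) fun _ => rfl]
    simp_rw [← MulChar.mul_apply, mul_inv_cancel]
    rw [MulChar.sum_one_eq_card_units, Fintype.card_units, Nat.cast_sub Fintype.card_pos]
    simp
  · have hbc : b - c ≠ 0 := sub_ne_zero.mpr h
    have hval : ∀ {x : F}, x ≠ 0 → χ x * χ⁻¹ x = 1 := fun {x} hx => by
      rw [← MulChar.mul_apply, mul_inv_cancel, MulChar.one_apply hx.isUnit]
    rw [← ((Equiv.mulLeft₀ (b - c) hbc).trans (Equiv.subRight b)).sum_comp]
    have key : ∀ x : F, χ ((Equiv.mulLeft₀ (b - c) hbc).trans (Equiv.subRight b) x + b) *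
        χ⁻¹ ((Equiv.mulLeft₀ (b - c) hbc).trans (Equiv.subRight b) x + c) =
        χ⁻¹ (-1) * (χ x * χ⁻¹ (1 - x)) := fun x => by
      have h1 : (b - c) * x - b + b = (b - c) * x := by ring
      have h2 : (b - c) * x - b + c = (b - c) * (-1 * (1 - x)) := by ring
      simp only [Equiv.trans_apply, Equiv.mulLeft₀_apply, Equiv.subRight_apply]
      rw [h1, h2, map_mul, map_mul, map_mul]
      linear_combination χ x * χ⁻¹ (-1) * χ⁻¹ (1 - x) * hval hbc
    simp_rw [key]
    rw [← mul_sum]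
    have := jacobiSum_nontrivial_inv hχ
    rw [jacobiSum] at this
    rw [this]
    linear_combination -hval (neg_ne_zero.mpr (one_ne_zero (α := F)))

theorem MulChar.sum_norm_sq_sum_add_le {F : Type*} [Field F] [Fintype F] {χ : MulChar F ℂ}
    (hχ : χ ≠ 1) (B : Finset F) :
    ∑ a, ‖∑ b ∈ B, χ (a + b)‖ ^ 2 ≤ Fintype.card F * #B := by
  classical
  have h : ((∑ a, ‖∑ b ∈ B, χ (a + b)‖ ^ 2 : ℝ) : ℂ) =
      ((Fintype.card F * #B - #B ^ 2 : ℝ) : ℂ) := by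
    push_cast
    simp_rw [← Complex.mul_conj', map_sum, sum_mul_sum]
    rw [sum_comm]
    have : ∀ b ∈ B, ∑ a, ∑ c ∈ B, χ (a + b) * (starRingEnd ℂ) (χ (a + c)) =
        Fintype.card F - #B := fun b hb => by
      rw [sum_comm]
      have hc : ∀ c, ∑ a, χ (a + b) * (starRingEnd ℂ) (χ (a + c)) =
          (if b = c then (Fintype.card F : ℂ) else 0) - 1 := fun c => by
        have := MulChar.sum_add_mul_inv_add hχ b c
        simp_rw [← MulChar.star_apply'] at this
        simp_rw [starRingEnd_apply]
        rw [this]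
        split_ifs <;> ring
      simp_rw [hc]
      simp [hb]
    rw [sum_congr rfl this]
    simp
    ring
  rw [Complex.ofReal_inj.mp h]
  nlinarith [sq_nonneg (#B : ℝ)]

theorem MulChar.norm_sum_sum_add_le {F : Type*} [Field F] [Fintype F] {χ : MulChar F ℂ}
    (hχ : χ ≠ 1) (A B : Finset F) :
    ‖∑ a ∈ A, ∑ b ∈ B, χ (a + b)‖ ≤ √(Fintype.card F) * ((#A + #B) / 2) := by
  have h1 : (∑ a ∈ A, ‖∑ b ∈ B, χ (a + b)‖) ^ 2 ≤ #A * (Fintype.card F * #B) :=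
    sq_sum_le_card_mul_sum_sq.trans <| by
      gcongr
      exact (sum_le_sum_of_subset_of_nonneg (subset_univ _) fun _ _ _ => by positivity).trans
        (MulChar.sum_norm_sq_sum_add_le hχ B)
  refine (norm_sum_le _ _).trans (abs_le_of_sq_le_sq' (h1.trans ?_) (by positivity)).2
  rw [mul_pow, Real.sq_sqrt (by positivity)]
  have : (0 : ℝ) ≤ Fintype.card F := by positivity
  nlinarith [mul_nonneg this (sq_nonneg ((#A : ℝ) - #B))]

theorem MulChar.norm_sum_sum_natCast_add_le {p : ℕ} [Fact p.Prime] {χ : MulChar (ZMod p) ℂ}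
    (hχ : χ ≠ 1) {A B : Finset ℕ} (hA : ∀ a ∈ A, a < p) (hB : ∀ b ∈ B, b < p) :
    ‖∑ a ∈ A, ∑ b ∈ B, χ ((a + b : ℕ) : ZMod p)‖ ≤ √p * ((#A + #B) / 2) := by
  classical
  have inj : ∀ {S : Finset ℕ}, (∀ a ∈ S, a < p) → Set.InjOn (Nat.cast : ℕ → ZMod p) S :=
    fun hS a ha b hb hab => by
      simpa [ZMod.val_cast_of_lt (hS _ ha), ZMod.val_cast_of_lt (hS _ hb)] using
        congrArg ZMod.val hab
  have := MulChar.norm_sum_sum_add_le hχ (A.image Nat.cast) (B.image Nat.cast)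
  rw [sum_image (inj hA), card_image_of_injOn (inj hA), card_image_of_injOn (inj hB),
    ZMod.card] at this
  simp_rw [sum_image (inj hB)] at this
  simpa only [Nat.cast_add] using this

theorem MulChar.norm_sum_sum_dvd_add_le {p : ℕ} [Fact p.Prime] {χ : MulChar (ZMod p) ℂ}
    (hχ : χ ≠ 1) {A B : Finset ℕ} (hA : ∀ a ∈ A, a < p) (hB : ∀ b ∈ B, b < p) {d : ℕ}
    (hd : 0 < d) :
    ‖∑ a ∈ A, ∑ b ∈ B, if d ∣ a + b then χ ((a + b : ℕ) : ZMod p) else 0‖ ≤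
      √p * ((#A + #B) / 2) := by
  have hmaps : ∀ a ∈ A, a % d ∈ range d := fun a _ => mem_range.mpr (Nat.mod_lt _ hd)
  rw [← sum_fiberwise_of_maps_to hmaps]
  have hsplit : ∀ c ∈ range d, ∑ a ∈ A with a % d = c,
      (∑ b ∈ B, if d ∣ a + b then χ ((a + b : ℕ) : ZMod p) else 0) =
      ∑ a ∈ A with a % d = c, ∑ b ∈ B with d ∣ c + b, χ ((a + b : ℕ) : ZMod p) := fun c _ =>
    sum_congr rfl fun a ha => by
      rw [sum_filter]
      refine sum_congr rfl fun b _ => ?_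
      rw [← (mem_filter.mp ha).2]
      congr 1
      simp [Nat.dvd_iff_mod_eq_zero, Nat.add_mod]
  rw [sum_congr rfl hsplit]
  have hbound : ∀ c ∈ range d,
      ‖∑ a ∈ A with a % d = c, ∑ b ∈ B with d ∣ c + b, χ ((a + b : ℕ) : ZMod p)‖ ≤
      √p * (((#{a ∈ A | a % d = c} : ℕ) + (#{b ∈ B | d ∣ c + b} : ℕ)) / 2) := fun c _ =>
    MulChar.norm_sum_sum_natCast_add_le hχ (fun a ha => hA a (mem_filter.mp ha).1)
      fun b hb => hB b (mem_filter.mp hb).1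
  refine (norm_sum_le _ _).trans ((sum_le_sum hbound).trans ?_)
  rw [← mul_sum, ← sum_div, sum_add_distrib]
  have h1 : ∑ c ∈ range d, #{a ∈ A | a % d = c} = #A := (card_eq_sum_card_fiberwise hmaps).symm
  have h2 : ∑ c ∈ range d, #{b ∈ B | d ∣ c + b} ≤ #B := by
    have hswap := sum_card_bipartiteAbove_eq_sum_card_bipartiteBelow (s := range d) (t := B)
      fun c b => d ∣ c + b
    simp only [bipartiteAbove, bipartiteBelow] at hswap
    rw [hswap, card_eq_sum_ones B]
    refine sum_le_sum fun b _ => card_le_one.mpr fun c hc c' hc' => ?_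
    simp only [mem_filter, mem_range] at hc hc'
    have : c ≡ c' [MOD d] := Nat.ModEq.add_right_cancel' b
      ((Nat.modEq_zero_iff_dvd.mpr hc.2).trans (Nat.modEq_zero_iff_dvd.mpr hc'.2).symm)
    exact this.eq_of_lt_of_lt hc.1 hc'.1
  have h1' : (∑ c ∈ range d, (#{a ∈ A | a % d = c} : ℝ)) = #A := by exact_mod_cast h1
  have h2' : (∑ c ∈ range d, (#{b ∈ B | d ∣ c + b} : ℝ)) ≤ #B := by exact_mod_cast h2
  gcongr
  exact h1'.le

theorem Nat.ite_forall_prime_not_dvd_eq_sum {R : Type*} [CommRing R] {P : Finset ℕ}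
    (hP : ∀ r ∈ P, r.Prime) (g : ℕ) :
    (if ∀ r ∈ P, ¬ r ∣ g then 1 else 0 : R) =
      ∑ t ∈ P.powerset, (-1) ^ #t * (if ∏ r ∈ t, r ∣ g then 1 else 0) := by
  have h1 : (if ∀ r ∈ P, ¬ r ∣ g then 1 else 0 : R) =
      ∏ r ∈ P, (-(if r ∣ g then 1 else 0) + 1) := by
    split_ifs with h
    · exact (prod_eq_one fun r hr => by simp [h r hr]).symm
    · push Not at h
      obtain ⟨r, hr, hrg⟩ := h
      exact (prod_eq_zero hr (by simp [hrg])).symm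
  rw [h1, prod_add_one]
  refine sum_congr rfl fun t ht => ?_
  rw [prod_neg]
  congr 1
  have hd : (∏ r ∈ t, r ∣ g) ↔ ∀ r ∈ t, r ∣ g :=
    ⟨fun h r hr => (dvd_prod_of_mem _ hr).trans h, fun h =>
      prod_primes_dvd _ (fun r hr => (hP r (mem_powerset.mp ht hr)).prime) h⟩
  simp_rw [hd]
  split_ifs with h
  · exact prod_eq_one fun r hr => by simp [h r hr]
  · push Not at h
    obtain ⟨r, hr, hrg⟩ := h
    exact prod_eq_zero hr (by simp [hrg])

theorem Nat.abs_card_filter_dvd_add_sub_le (a h : ℕ) {d : ℕ} (hd : 0 < d) :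
    |(#{b ∈ Ioc 0 h | d ∣ a + b} : ℝ) - h / d| ≤ 1 := by
  have hcard : #{b ∈ Ioc 0 h | d ∣ a + b} = #{x ∈ Ioc (a : ℤ) (a + h) | (d : ℤ) ∣ x} := by
    refine card_nbij' (fun b => (a + b : ℤ)) (fun x => (x - a).toNat) ?_ ?_ ?_ ?_
    · intro b hb
      simp only [coe_filter, mem_Ioc, Set.mem_ofPred_eq] at hb ⊢
      exact ⟨by omega, by exact_mod_cast hb.2⟩
    · intro x hx
      simp only [coe_filter, mem_Ioc, Set.mem_ofPred_eq] at hx ⊢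
      refine ⟨by omega, ?_⟩
      have : ((a + (x - a).toNat : ℕ) : ℤ) = x := by omega
      exact_mod_cast this ▸ hx.2
    · intro b _
      simp
    · intro x hx
      simp only [coe_filter, mem_Ioc, Set.mem_ofPred_eq] at hx
      simp only
      omega
  have hd' : (0 : ℚ) < d := by exact_mod_cast hd
  have hZ := Int.Ioc_filter_dvd_card (a : ℤ) (a + h) (Int.natCast_pos.mpr hd)
  rw [← hcard] at hZ
  push_cast at hZ
  have hmono : ⌊(a : ℚ) / d⌋ ≤ ⌊((a : ℚ) + h) / d⌋ := by gcongr; simp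
  rw [max_eq_left (by linarith)] at hZ
  have hQ : |(#{b ∈ Ioc 0 h | d ∣ a + b} : ℚ) - h / d| ≤ 1 := by
    have hZ' : (#{b ∈ Ioc 0 h | d ∣ a + b} : ℚ) = ⌊((a : ℚ) + h) / d⌋ - ⌊(a : ℚ) / d⌋ := by
      exact_mod_cast hZ
    have e : ((a : ℚ) + h) / d = a / d + h / d := add_div _ _ _
    have := Int.floor_le (((a : ℚ) + h) / d)
    have := Int.lt_floor_add_one (((a : ℚ) + h) / d)
    have := Int.floor_le ((a : ℚ) / d)
    have := Int.lt_floor_add_one ((a : ℚ) / d)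
    rw [hZ', abs_le]
    constructor <;> linarith
  have := (Rat.cast_le (K := ℝ)).mpr hQ
  push_cast at this
  exact this

theorem Nat.sum_sum_coprime_ge {n : ℕ} (hn : n ≠ 0) (A : Finset ℕ) (h : ℕ) :
    (#A : ℝ) * (h * (n.totient / n) - 2 ^ #n.primeFactors) ≤
      ∑ a ∈ A, ∑ b ∈ Ioc 0 h, if ∀ r ∈ n.primeFactors, ¬ r ∣ a + b then (1 : ℝ) else 0 := by
  rw [← nsmul_eq_mul]
  refine card_nsmul_le_sum _ _ _ fun a _ => ?_
  simp_rw [Nat.ite_forall_prime_not_dvd_eq_sum (fun r hr => prime_of_mem_primeFactors hr)]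
  rw [sum_comm]
  simp_rw [← mul_sum, sum_boole]
  have hphi : (n.totient : ℝ) / n =
      ∑ t ∈ n.primeFactors.powerset, (-1) ^ #t / ∏ r ∈ t, (r : ℝ) := by
    have := congrArg (fun x : ℚ => (x : ℝ)) (Nat.totient_eq_mul_prod_factors n)
    push_cast at this
    rw [this, mul_div_cancel_left₀ _ (by exact_mod_cast hn)]
    simp_rw [sub_eq_neg_add]
    rw [prod_add_one]
    refine sum_congr rfl fun t _ => ?_
    rw [prod_neg, prod_inv_distrib, div_eq_mul_inv]
  have hpow : (2 : ℝ) ^ #n.primeFactors = ∑ t ∈ n.primeFactors.powerset, 1 := by simp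
  rw [hphi, hpow, mul_sum, ← sum_sub_distrib]
  refine sum_le_sum fun t ht => ?_
  have hpos : 0 < ∏ r ∈ t, r :=
    prod_pos fun r hr => pos_of_mem_primeFactors (mem_powerset.mp ht hr)
  have := abs_le.mp (Nat.abs_card_filter_dvd_add_sub_le a h hpos)
  push_cast at this
  rw [show (h : ℝ) * ((-1) ^ #t / ∏ r ∈ t, (r : ℝ)) = (-1) ^ #t * (h / ∏ r ∈ t, (r : ℝ)) by ring]
  rcases neg_one_pow_eq_or ℝ #t with e | e <;> rw [e] <;> linarith

theorem Finset.one_div_card_add_one_le_prod {s : Finset ℕ} (hs : ∀ r ∈ s, 2 ≤ r) :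
    (1 : ℝ) / (#s + 1) ≤ ∏ r ∈ s, (1 - (r : ℝ)⁻¹) := by
  induction s using Finset.induction_on_max with
  | empty => simp
  | insert m s hm ih =>
    have hmem : m ∉ s := fun h => (hm m h).false
    have hcard : #s + 2 ≤ m := by
      have hsub : s ⊆ Ico 2 m := fun r hr => mem_Ico.mpr ⟨hs r (mem_insert_of_mem hr), hm r hr⟩
      have := card_le_card hsub
      rw [Nat.card_Ico] at this
      have := hs m (mem_insert_self _ _)
      omega
    rw [prod_insert hmem, card_insert_of_notMem hmem]
    have hcard' : (#s : ℝ) + 2 ≤ m := by exact_mod_cast hcard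
    have h1 : (m : ℝ)⁻¹ ≤ 1 / (#s + 2) := by
      rw [← one_div]; gcongr
    have h2 := ih fun r hr => hs r (mem_insert_of_mem hr)
    have h3 : (1 : ℝ) / ((#s + 1 : ℕ) + 1) = (1 - 1 / (#s + 2)) * (1 / (#s + 1)) := by
      push_cast; field_simp; ring
    rw [h3]
    gcongr
    exact sub_nonneg.mpr (inv_le_one_of_one_le₀ (by linarith [(#s).cast_nonneg (α := ℝ)]))

theorem Finset.factorial_card_add_one_le_prod {s : Finset ℕ} (hs : ∀ r ∈ s, 2 ≤ r) :
    (#s + 1).factorial ≤ ∏ r ∈ s, r := by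
  induction s using Finset.induction_on_max with
  | empty => simp
  | insert m s hm ih =>
    have hmem : m ∉ s := fun h => (hm m h).false
    have hcard : #s + 2 ≤ m := by
      have hsub : s ⊆ Ico 2 m := fun r hr => mem_Ico.mpr ⟨hs r (mem_insert_of_mem hr), hm r hr⟩
      have := card_le_card hsub
      rw [Nat.card_Ico] at this
      have := hs m (mem_insert_self _ _)
      omega
    rw [prod_insert hmem, card_insert_of_notMem hmem, Nat.factorial_succ]
    exact Nat.mul_le_mul hcard (ih fun r hr => hs r (mem_insert_of_mem hr))

theorem Finset.one_sub_sum_le_prod_one_sub {ι : Type*} {s : Finset ι} {f : ι → ℝ}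
    (h0 : ∀ i ∈ s, 0 ≤ f i) (h1 : ∀ i ∈ s, f i ≤ 1) :
    1 - ∑ i ∈ s, f i ≤ ∏ i ∈ s, (1 - f i) := by
  classical
  induction s using Finset.induction_on with
  | empty => simp
  | insert i s hi ih =>
    rw [sum_insert hi, prod_insert hi]
    have hprod : ∏ j ∈ s, (1 - f j) ≤ 1 := prod_le_one
      (fun j hj => sub_nonneg.mpr (h1 j (mem_insert_of_mem hj)))
      fun j hj => sub_le_self _ (h0 j (mem_insert_of_mem hj))
    nlinarith [h0 i (mem_insert_self _ _),
      ih (fun j hj => h0 j (mem_insert_of_mem hj)) fun j hj => h1 j (mem_insert_of_mem hj)]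

theorem Nat.exists_odd_prime_dvd_le {n : ℕ} (hn : Even n) (hn0 : n ≠ 0)
    (hphi : (n.totient : ℝ) / n ≤ 9 / 22) :
    ∃ l, l.Prime ∧ l ∣ n ∧ l ≠ 2 ∧ 2 * l ≤ 11 * #n.primeFactors := by
  by_contra! H
  have h2 : 2 ∈ n.primeFactors := by simp [hn0, hn.two_dvd, Nat.prime_two]
  have h := congrArg (fun x : ℚ => (x : ℝ)) (Nat.totient_eq_mul_prod_factors n)
  push_cast at h
  rw [h, mul_div_cancel_left₀ _ (by exact_mod_cast hn0), ← mul_prod_erase _ _ h2] at hphi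
  have h3 := one_sub_sum_le_prod_one_sub (s := n.primeFactors.erase 2)
    (f := fun r => (r : ℝ)⁻¹) (fun r _ => by positivity) (fun r hr => inv_le_one_of_one_le₀ <| by
      exact_mod_cast (prime_of_mem_primeFactors (mem_of_mem_erase hr)).one_le)
  have hw : 0 < #n.primeFactors := Finset.card_pos.mpr ⟨2, h2⟩
  have hw' : (0 : ℝ) < #n.primeFactors := by exact_mod_cast hw
  have h4 : ∑ r ∈ n.primeFactors.erase 2, (r : ℝ)⁻¹ ≤
      #(n.primeFactors.erase 2) • (2 / (11 * #n.primeFactors) : ℝ) := by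
    refine sum_le_card_nsmul _ _ _ fun r hr => ?_
    obtain ⟨hr2, hr⟩ := mem_erase.mp hr
    have := H r (prime_of_mem_primeFactors hr) (dvd_of_mem_primeFactors hr) hr2
    have : (11 : ℝ) * #n.primeFactors ≤ 2 * r := by exact_mod_cast this.le
    rw [← one_div, div_le_div_iff₀
      (by exact_mod_cast (prime_of_mem_primeFactors hr).pos) (by positivity)]
    linarith
  rw [card_erase_of_mem h2, nsmul_eq_mul, Nat.cast_sub hw] at h4
  have h5 : ((#n.primeFactors : ℝ) - (1 : ℕ)) * (2 / (11 * #n.primeFactors)) < 2 / 11 := by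
    rw [mul_div_assoc', div_lt_div_iff₀ (by positivity) (by norm_num)]
    push_cast
    linarith
  push_cast at *
  linarith

theorem lt_factorial_of_le {w : ℕ} (hw : 25 ≤ w) :
    968 * (w * (w + 1)) ^ 2 * 4 ^ w < (w + 1).factorial := by
  induction w, hw using Nat.le_induction with
  | base => norm_num [Nat.factorial]
  | succ w hw ih =>
    rw [Nat.factorial_succ (w + 1)]
    have h1 : ((w + 1) * (w + 1 + 1)) ^ 2 * 4 ≤ (w + 1 + 1) * (w * (w + 1)) ^ 2 := by
      have : 4 * (w + 2) ≤ w ^ 2 := by nlinarith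
      calc ((w + 1) * (w + 1 + 1)) ^ 2 * 4 = (w + 2) * (w + 1) ^ 2 * (4 * (w + 2)) := by ring
        _ ≤ (w + 2) * (w + 1) ^ 2 * w ^ 2 := by gcongr
        _ = _ := by ring
    calc 968 * ((w + 1) * (w + 1 + 1)) ^ 2 * 4 ^ (w + 1)
        = 968 * 4 ^ w * (((w + 1) * (w + 1 + 1)) ^ 2 * 4) := by ring
      _ ≤ 968 * 4 ^ w * ((w + 1 + 1) * (w * (w + 1)) ^ 2) := by gcongr
      _ = (w + 1 + 1) * (968 * (w * (w + 1)) ^ 2 * 4 ^ w) := by ring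
      _ < _ := by gcongr

theorem Nat.lt_of_card_primeFactors {n : ℕ} (hn : 10 ^ 27 ≤ n) :
    968 * (#n.primeFactors * (#n.primeFactors + 1)) ^ 2 * 4 ^ #n.primeFactors < n := by
  have hfac : (#n.primeFactors + 1).factorial ≤ n :=
    (factorial_card_add_one_le_prod fun r hr => (prime_of_mem_primeFactors hr).two_le).trans
      (Nat.le_of_dvd (by omega) (prod_primeFactors_dvd n))
  rcases le_total 25 #n.primeFactors with h | h
  · exact (lt_factorial_of_le h).trans_le hfac
  · calc _ ≤ 968 * (25 * (25 + 1)) ^ 2 * 4 ^ 25 := by gcongr; norm_num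
      _ < n := by norm_num at hn ⊢; omega

theorem MulChar.norm_sum_sum_coprime_add_le {p : ℕ} [Fact p.Prime] {χ : MulChar (ZMod p) ℂ}
    (hχ : χ ≠ 1) {A B : Finset ℕ} (hA : ∀ a ∈ A, a < p) (hB : ∀ b ∈ B, b < p) {P : Finset ℕ}
    (hP : ∀ r ∈ P, r.Prime) :
    ‖∑ a ∈ A, ∑ b ∈ B, if ∀ r ∈ P, ¬ r ∣ a + b then χ ((a + b : ℕ) : ZMod p) else 0‖ ≤
      2 ^ #P * (√p * ((#A + #B) / 2)) := by
  have h : ∑ a ∈ A, ∑ b ∈ B, (if ∀ r ∈ P, ¬ r ∣ a + b then χ ((a + b : ℕ) : ZMod p) else 0) =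
      ∑ t ∈ P.powerset, (-1) ^ #t * ∑ a ∈ A, ∑ b ∈ B,
        if ∏ r ∈ t, r ∣ a + b then χ ((a + b : ℕ) : ZMod p) else 0 := by
    simp_rw [mul_sum]
    symm
    rw [sum_comm]
    refine sum_congr rfl fun a _ => ?_
    rw [sum_comm]
    refine sum_congr rfl fun b _ => ?_
    have := congrArg (· * χ ((a + b : ℕ) : ZMod p))
      (Nat.ite_forall_prime_not_dvd_eq_sum (R := ℂ) hP (a + b))
    simpa only [sum_mul, mul_assoc, ite_mul, one_mul, zero_mul] using this.symm
  rw [h, show (2 : ℝ) ^ #P = #P.powerset by simp, ← nsmul_eq_mul]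
  refine (norm_sum_le _ _).trans (sum_le_card_nsmul _ _ _ fun t ht => ?_)
  rw [norm_mul, norm_pow, norm_neg, norm_one, one_pow, one_mul]
  exact MulChar.norm_sum_sum_dvd_add_le hχ hA hB
    (prod_pos fun r hr => (hP r (mem_powerset.mp ht hr)).pos)

theorem MulChar.sum_neg_one_pow_mul_pow_eq_zero {F : Type*} [Field F] {χ : MulChar F ℂ} {m : ℕ}
    (hm : Even m) (hχ : χ ^ m = 1) {x : F} (hx : x ≠ 0) (hχx : χ x ≠ -1) :
    ∑ j ∈ range m, (-1) ^ j * (χ ^ j) x = 0 := by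
  have hpow : ∀ j, (χ ^ j) x = χ x ^ j := fun j => by
    simpa using MulChar.pow_apply_coe χ j (Units.mk0 x hx)
  simp_rw [hpow, ← mul_pow]
  have hne : -1 * χ x ≠ 1 := fun h => hχx (by linear_combination -h)
  have hone : (-1 * χ x) ^ m = 1 := by
    rw [mul_pow, hm.neg_one_pow, one_mul, ← hpow, hχ, MulChar.one_apply hx.isUnit]
  rw [geom_sum_eq hne, hone, sub_self, zero_div]

theorem MulChar.exists_apply_eq_neg_one {p : ℕ} [Fact p.Prime] {χ : MulChar (ZMod p) ℂ} {l : ℕ}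
    (hl : 0 < l) (hχ : orderOf χ = 2 * l) {h : ℕ} (hh : 2 * h = p - 1) (hh0 : 0 < h)
    (hbig : 2 ^ #(p - 1).primeFactors * (1 + (2 * l - 1) * √p) <
      h * ((p - 1).totient / (p - 1 : ℕ) : ℝ)) :
    ∃ g, 1 < g ∧ g ≤ p - 1 ∧ g.Coprime (p - 1) ∧ χ (g : ZMod p) = -1 := by
  by_contra! H
  have hn : p - 1 ≠ 0 := by omega
  set P := (p - 1).primeFactors with hPdef
  set S : ℕ → ℂ := fun j => ∑ a ∈ Ioc 0 h, ∑ b ∈ Ioc 0 h,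
    if ∀ r ∈ P, ¬ r ∣ a + b then (χ ^ j) ((a + b : ℕ) : ZMod p) else 0 with hS
  have hne0 : ∀ a ∈ Ioc 0 h, ∀ b ∈ Ioc 0 h, ((a + b : ℕ) : ZMod p) ≠ 0 := by
    intro a ha b hb h0
    rw [mem_Ioc] at ha hb
    have := Nat.le_of_dvd (by omega) ((ZMod.natCast_eq_zero_iff _ _).mp h0)
    omega
  have hzero : ∑ j ∈ range (2 * l), (-1) ^ j * S j = 0 := by
    simp_rw [hS, mul_sum]
    rw [sum_comm]
    refine sum_eq_zero fun a ha => ?_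
    rw [sum_comm]
    refine sum_eq_zero fun b hb => ?_
    split_ifs with hab
    · refine MulChar.sum_neg_one_pow_mul_pow_eq_zero (even_two_mul l) (hχ ▸ pow_orderOf_eq_one χ)
        (hne0 a ha b hb) (H _ ?_ ?_ ?_)
      · rw [mem_Ioc] at ha hb; omega
      · rw [mem_Ioc] at ha hb; omega
      · refine Nat.coprime_of_dvd fun r hr h1 h2 => hab r ?_ h1
        exact Nat.mem_primeFactors.mpr ⟨hr, h2, hn⟩
    · simp
  have hmain : h * (h * ((p - 1).totient / (p - 1 : ℕ) : ℝ) - 2 ^ #P) ≤ ‖S 0‖ := by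
    have h1 := Nat.sum_sum_coprime_ge hn (Ioc 0 h) h
    rw [Nat.card_Ioc, Nat.sub_zero] at h1
    refine h1.trans ((le_abs_self _).trans ?_)
    rw [← Real.norm_eq_abs, ← Complex.norm_real, hS]
    push_cast
    refine (congrArg norm (sum_congr rfl fun a ha => sum_congr rfl fun b hb => ?_)).le
    rw [pow_zero, MulChar.one_apply (by exact_mod_cast (hne0 a ha b hb).isUnit)]
    split_ifs <;> simp
  have herr : ∀ j ∈ range (2 * l - 1), ‖(-1) ^ (j + 1) * S (j + 1)‖ ≤ 2 ^ #P * (√p * h) := by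
    intro j hj
    rw [norm_mul, norm_pow, norm_neg, norm_one, one_pow, one_mul]
    have hlt : ∀ a ∈ Ioc 0 h, a < p := fun a ha => by rw [mem_Ioc] at ha; omega
    have := MulChar.norm_sum_sum_coprime_add_le (χ := χ ^ (j + 1))
      (pow_ne_one_of_lt_orderOf (by omega) (by rw [mem_range] at hj; omega)) hlt hlt
      (fun r hr => Nat.prime_of_mem_primeFactors (n := p - 1) hr)
    simpa [hS, hPdef] using this
  rw [show 2 * l = 2 * l - 1 + 1 by omega, sum_range_succ', pow_zero, one_mul] at hzero
  have hle : ‖S 0‖ ≤ (2 * l - 1 : ℕ) * (2 ^ #P * (√p * h)) := by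
    rw [eq_neg_of_add_eq_zero_right hzero, norm_neg, ← nsmul_eq_mul]
    simpa using (norm_sum_le _ _).trans (sum_le_card_nsmul _ _ _ herr)
  rw [Nat.cast_sub (by omega)] at hle
  push_cast at hle
  have hh' : (0 : ℝ) < h := by exact_mod_cast hh0
  nlinarith [mul_lt_mul_of_pos_left hbig hh']

theorem isQNRNP_of_mulChar_eq_neg_one {p : ℕ} [Fact p.Prime] {χ : MulChar (ZMod p) ℂ} {l : ℕ}
    (hl : Odd l) (hl1 : 1 < l) (hχ : orderOf χ = 2 * l) {g : ℤ} (hg : χ (g : ZMod p) = -1) :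
    IsQNRNP p g := by
  constructor
  · rintro ⟨x, hx⟩
    have hx' : (x : ZMod p) ^ 2 = g := by
      exact_mod_cast (ZMod.intCast_eq_intCast_iff _ _ _).mpr hx
    rw [← hx', map_pow] at hg
    have hx0 : (x : ZMod p) ≠ 0 := fun h0 => by
      rw [h0, MulChar.map_zero] at hg
      norm_num at hg
    have h1 : χ (x : ZMod p) ^ (2 * l) = 1 := by
      have h2 := MulChar.pow_apply_coe χ (2 * l) (Units.mk0 _ hx0)
      rw [← hχ, pow_orderOf_eq_one, MulChar.one_apply_coe, hχ] at h2
      simpa using h2.symm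
    rw [pow_mul, hg, hl.neg_one_pow] at h1
    norm_num at h1
  · intro hroot
    have h1 : χ ^ 2 = 1 := by
      ext a
      obtain ⟨k, hk⟩ := hroot a a.ne_zero
      rw [MulChar.pow_apply_coe, MulChar.one_apply_coe, ← hk, map_pow, hg, ← pow_mul, mul_comm,
        pow_mul]
      norm_num
    have := Nat.le_of_dvd two_pos (orderOf_dvd_of_pow_eq_one h1)
    omega

theorem ten_pow_lt_of_log_log {ε : ℝ} (hε₁ : 1 / 11 ≤ ε) (hε₂ : ε < 1 / 2) {p : ℕ}
    (hlog : Real.log (Real.log p) > Real.log 6.83 / (1 / 2 - ε)) : 10 ^ 27 < p := by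
  have h1 : (9 / 5 : ℝ) ≤ Real.log 6.83 := by
    rw [Real.le_log_iff_exp_le (by norm_num)]
    refine le_of_pow_le_pow_left₀ (n := 5) (by norm_num) (by norm_num) ?_
    rw [← Real.exp_nat_mul, show ((5 : ℕ) : ℝ) * (9 / 5) = (9 : ℕ) * 1 by norm_num,
      Real.exp_nat_mul]
    calc Real.exp 1 ^ 9 ≤ 2.72 ^ 9 := by gcongr; linarith [Real.exp_one_lt_d9]
      _ ≤ _ := by norm_num
  have h2 : (22 / 5 : ℝ) < Real.log (Real.log p) := by
    refine lt_of_le_of_lt ?_ hlog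
    rw [le_div_iff₀ (by linarith)]
    linarith
  have hpos : 0 < Real.log p := by
    refine (Real.log_natCast_nonneg p).lt_of_ne fun h0 => ?_
    rw [← h0, Real.log_zero] at h2
    norm_num at h2
  have hexp : ∀ k : ℕ, (2.718 : ℝ) ^ k ≤ Real.exp k := fun k => by
    rw [← mul_one (k : ℝ), Real.exp_nat_mul]
    gcongr
    linarith [Real.exp_one_gt_d9]
  have h3 : (64 : ℝ) < Real.log p := by
    refine lt_of_le_of_lt ?_ ((Real.lt_log_iff_exp_lt hpos).mp h2)
    refine le_of_pow_le_pow_left₀ (n := 5) (by norm_num) (by positivity) ?_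
    rw [← Real.exp_nat_mul, show ((5 : ℕ) : ℝ) * (22 / 5) = (22 : ℕ) by norm_num]
    exact le_trans (by norm_num) (hexp 22)
  have hp0 : (0 : ℝ) < p := by
    refine (Nat.cast_nonneg p).lt_of_ne fun h0 => ?_
    rw [← h0, Real.log_zero] at hpos
    exact hpos.false
  have h4 := (hexp 64).trans_lt ((Real.lt_log_iff_exp_lt hp0).mp (by exact_mod_cast h3))
  have : (10 ^ 27 : ℝ) < p := lt_of_le_of_lt (by norm_num) h4
  exact_mod_cast this

theorem two_pow_card_primeFactors_mul_lt {n l : ℕ} (hn : 10 ^ 27 ≤ n)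
    (hl : 2 * l ≤ 11 * #n.primeFactors) :
    (2 : ℝ) ^ #n.primeFactors * (2 * l * √((n + 1 : ℕ) : ℝ)) < n.totient / 2 := by
  have hn0 : n ≠ 0 := by omega
  set w := #n.primeFactors with hw
  have hphi : (n : ℝ) / (w + 1) ≤ n.totient := by
    have h := congrArg (fun x : ℚ => (x : ℝ)) (Nat.totient_eq_mul_prod_factors n)
    push_cast at h
    rw [h, div_eq_mul_one_div]
    gcongr
    exact Finset.one_div_card_add_one_le_prod fun r hr => (Nat.prime_of_mem_primeFactors hr).two_le
  have hnw : (968 : ℝ) * (w * (w + 1)) ^ 2 * 4 ^ w < n := by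
    exact_mod_cast Nat.lt_of_card_primeFactors hn
  have hl' : (2 : ℝ) * l ≤ 11 * w := by exact_mod_cast hl
  have hn1 : ((n + 1 : ℕ) : ℝ) ≤ 2 * n := by exact_mod_cast (by omega : n + 1 ≤ 2 * n)
  have hpos : (0 : ℝ) < n := by exact_mod_cast Nat.pos_of_ne_zero hn0
  have hsq : (22 * (w * (w + 1)) * 2 ^ w * √((n + 1 : ℕ) : ℝ)) < n := by
    refine lt_of_pow_lt_pow_left₀ 2 hpos.le ?_
    rw [mul_pow, Real.sq_sqrt (by positivity), mul_pow, ← pow_mul, mul_comm w 2, pow_mul]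
    calc _ ≤ (22 * (w * (w + 1) : ℝ)) ^ 2 * (2 ^ 2) ^ w * (2 * n) := by gcongr
      _ = 968 * (w * (w + 1)) ^ 2 * 4 ^ w * n := by norm_num; ring
      _ < n * n := by gcongr
      _ = _ := (sq _).symm
  calc (2 : ℝ) ^ w * (2 * l * √((n + 1 : ℕ) : ℝ)) ≤
        2 ^ w * (11 * w * √((n + 1 : ℕ) : ℝ)) := by gcongr
    _ = 22 * (w * (w + 1)) * 2 ^ w * √((n + 1 : ℕ) : ℝ) / (2 * (w + 1)) := by field_simp; ring
    _ < n / (2 * (w + 1)) := by gcongr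
    _ = n / (w + 1) / 2 := by field_simp
    _ ≤ _ := by gcongr

end

theorem stmt1 (q : ℕ) (hq : 1 ≤ q) (ε : ℝ) (hε₁ : 1 / 11 ≤ ε) (hε₂ : ε < 1 / 2)
    (p : ℕ) (hp : p.Prime) (hpq : p ≡ 1 [MOD q])
    (hlog : Real.log (Real.log p) > Real.log 6.83 / (1 / 2 - ε))
    (hphi : ((p - 1 : ℕ).totient : ℝ) / ((p : ℝ) - 1) ≤ 1 / 2 - ε) :
    ∃ g : ℕ, 1 < g ∧ g < p - 1 ∧ Nat.gcd g ((p - 1) / q) = 1 ∧ IsQNRNP p (g : ℤ) := by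
  have : Fact p.Prime := ⟨hp⟩
  have hbig := ten_pow_lt_of_log_log hε₁ hε₂ hlog
  have heven : Even (p - 1) := hp.even_sub_one (by omega)
  obtain ⟨h, hh⟩ := heven.two_dvd
  have hcast : ((p - 1 : ℕ) : ℝ) = p - 1 := by rw [Nat.cast_sub hp.one_le, Nat.cast_one]
  obtain ⟨l, hl, hln, hl2, hlw⟩ := Nat.exists_odd_prime_dvd_le heven (by omega)
    (by rw [hcast]; linarith : ((p - 1).totient : ℝ) / (p - 1 : ℕ) ≤ 9 / 22)
  have hlodd : Odd l := hl.odd_of_ne_two hl2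
  have h2l : 2 * l ∣ p - 1 :=
    (Nat.coprime_two_left.mpr hlodd).mul_dvd_of_dvd_of_dvd heven.two_dvd hln
  obtain ⟨χ, hχ⟩ := MulChar.exists_mulChar_orderOf (ZMod p) (n := 2 * l) (by rwa [ZMod.card])
    (Complex.isPrimitiveRoot_exp (2 * l) (by have := hl.pos; omega))
  have hineq := two_pow_card_primeFactors_mul_lt (n := p - 1) (by omega) hlw
  rw [Nat.sub_add_cancel hp.one_le] at hineq
  obtain ⟨g, hg1, hgp, hgc, hgχ⟩ :=
      MulChar.exists_apply_eq_neg_one hl.pos hχ hh.symm (by omega) <| by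
    have hh' : ((p - 1 : ℕ) : ℝ) = 2 * h := by exact_mod_cast hh
    have hh0 : (0 : ℝ) < h := by exact_mod_cast (by omega : 0 < h)
    have hsqrt : 1 ≤ √(p : ℝ) := Real.one_le_sqrt.mpr (by exact_mod_cast hp.one_le)
    have e : (h : ℝ) * ((p - 1).totient / (p - 1 : ℕ)) = (p - 1).totient / 2 := by
      rw [hh']; field_simp
    rw [e]
    refine lt_of_le_of_lt ?_ hineq
    gcongr
    linarith
  refine ⟨g, hg1, hgp.lt_of_ne ?_, ?_, isQNRNP_of_mulChar_eq_neg_one hlodd hl.one_lt hχ ?_⟩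
  · rintro rfl
    rw [Nat.coprime_self] at hgc
    omega
  · have hdvd : q ∣ p - 1 := (Nat.modEq_iff_dvd' hp.one_le).mp hpq.symm
    exact hgc.coprime_dvd_right (Nat.div_dvd_of_dvd hdvd)
  · exact_mod_cast hgχ
end

section
/- For all primes p ≥ 5, the number ω(p−1) of distinct prime divisors of p−1 satisfies ω(p−1) ≤ 1.385 · (log p)/(log log p). -/
/-- The product of a finite set of primes is at least the product of the first `#S` primes. -/
theorem prod_nth_prime_le_prod (k : ℕ) :
    ∀ S : Finset ℕ, (∀ q ∈ S, q.Prime) → S.card = k →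
      ∏ i ∈ Finset.range k, Nat.nth Nat.Prime i ≤ ∏ q ∈ S, q := by
  induction k with
  | zero =>
    intro S _ hc
    simp [Finset.card_eq_zero.mp hc]
  | succ k ih =>
    intro S hS hc
    have hne : S.Nonempty := Finset.card_pos.mp (by lia)
    have hM := S.max'_mem hne
    set M := S.max' hne
    have hcard : (S.erase M).card = k := by rw [Finset.card_erase_of_mem hM]; lia
    have hcount : k ≤ Nat.count Nat.Prime M := by
      rw [Nat.count_eq_card_filter_range, ← hcard]
      refine Finset.card_le_card fun q hq => ?_
      have hqS := Finset.mem_of_mem_erase hq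
      exact Finset.mem_filter.mpr ⟨Finset.mem_range.mpr
        (lt_of_le_of_ne (S.le_max' q hqS) (Finset.ne_of_mem_erase hq)), hS q hqS⟩
    have hnth : Nat.nth Nat.Prime k ≤ M :=
      (Nat.nth_monotone Nat.infinite_setOfPred_prime hcount).trans_eq (Nat.nth_count (hS M hM))
    rw [Finset.prod_range_succ, ← Finset.prod_erase_mul S _ hM]
    exact Nat.mul_le_mul (ih _ (fun q hq => hS q (Finset.mem_of_mem_erase hq)) hcard) hnth

theorem count_prime_add_six_le {n : ℕ} (hn : 4 ≤ n) :
    Nat.count Nat.Prime (n + 6) ≤ Nat.count Nat.Prime n + 2 := by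
  have key : ∀ m, 4 ≤ m → (m % 6 = 0 ∨ m % 6 = 2 ∨ m % 6 = 3 ∨ m % 6 = 4) → ¬ m.Prime := by
    intro m hm h hp
    have : 2 ∣ m ∨ 3 ∣ m := by lia
    rcases this with h2 | h3
    · have := (Nat.prime_dvd_prime_iff_eq Nat.prime_two hp).mp h2
      lia
    · have := (Nat.prime_dvd_prime_iff_eq Nat.prime_three hp).mp h3
      lia
  have h0 := key n hn
  have h1 := key (n + 1) (by lia)
  have h2 := key (n + 2) (by lia)
  have h3 := key (n + 3) (by lia)
  have h4 := key (n + 4) (by lia)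
  have h5 := key (n + 5) (by lia)
  simp only [Nat.count_succ]
  split_ifs <;> lia

theorem three_mul_count_prime_le (n : ℕ) (hn : 38 ≤ n) : 3 * Nat.count Nat.Prime n + 1 ≤ n := by
  induction n using Nat.strong_induction_on with
  | _ n ih =>
    by_cases h : n < 44
    · interval_cases n <;> decide
    · have h1 := ih (n - 6) (by lia) (by lia)
      have h2 := count_prime_add_six_le (n := n - 6) (by lia)
      rw [Nat.sub_add_cancel (by lia)] at h2
      lia

theorem nth_prime_eq {q i : ℕ} (hq : q.Prime) (hi : Nat.count Nat.Prime q = i) :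
    Nat.nth Nat.Prime i = q :=
  hi ▸ Nat.nth_count hq

theorem three_mul_succ_le_nth_prime {k : ℕ} (hk : 11 ≤ k) :
    3 * (k + 1) ≤ Nat.nth Nat.Prime k := by
  have h11 : Nat.nth Nat.Prime 11 = 37 := nth_prime_eq (by norm_num) (by decide)
  have h37 : 37 ≤ Nat.nth Nat.Prime k :=
    h11.symm.trans_le (Nat.nth_monotone Nat.infinite_setOfPred_prime hk)
  have h := three_mul_count_prime_le (Nat.nth Nat.Prime k + 1) (by lia)
  rw [Nat.count_succ, if_pos (Nat.prime_nth_prime k),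
    Nat.count_nth_of_infinite Nat.infinite_setOfPred_prime] at h
  lia

theorem succ_pow_le_three_mul_pow (k : ℕ) : (k + 1) ^ k ≤ 3 * k ^ k := by
  rcases Nat.eq_zero_or_pos k with rfl | hk
  · norm_num
  have hk' : (0 : ℝ) < k := by exact_mod_cast hk
  have h1 : ((k : ℝ) + 1) ≤ k * Real.exp (1 / k) := by
    have := mul_le_mul_of_nonneg_left (Real.add_one_le_exp (1 / (k : ℝ))) hk'.le
    rwa [mul_add, mul_one_div_cancel hk'.ne', mul_one, add_comm] at this
  have h2 : ((k : ℝ) + 1) ^ k ≤ 3 * (k : ℝ) ^ k := by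
    calc ((k : ℝ) + 1) ^ k ≤ (k * Real.exp (1 / k)) ^ k := by gcongr
      _ = Real.exp 1 * (k : ℝ) ^ k := by
        rw [mul_pow, ← Real.exp_nat_mul, mul_one_div_cancel hk'.ne', mul_comm]
      _ ≤ 3 * (k : ℝ) ^ k := by
        gcongr
        linarith [Real.exp_one_lt_d9]
  exact_mod_cast h2

theorem prod_nth_prime_range_eq :
    ∏ i ∈ Finset.range 4, Nat.nth Nat.Prime i = 210 ∧
    ∏ i ∈ Finset.range 5, Nat.nth Nat.Prime i = 2310 ∧
    ∏ i ∈ Finset.range 6, Nat.nth Nat.Prime i = 30030 ∧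
    ∏ i ∈ Finset.range 7, Nat.nth Nat.Prime i = 510510 ∧
    ∏ i ∈ Finset.range 8, Nat.nth Nat.Prime i = 9699690 ∧
    ∏ i ∈ Finset.range 9, Nat.nth Nat.Prime i = 223092870 ∧
    ∏ i ∈ Finset.range 10, Nat.nth Nat.Prime i = 6469693230 ∧
    ∏ i ∈ Finset.range 11, Nat.nth Nat.Prime i = 200560490130 ∧
    ∏ i ∈ Finset.range 12, Nat.nth Nat.Prime i = 7420738134810 := by
  simp only [Finset.prod_range_succ, Finset.prod_range_zero,
    nth_prime_eq (q := 2) (i := 0) (by norm_num) (by decide),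
    nth_prime_eq (q := 3) (i := 1) (by norm_num) (by decide),
    nth_prime_eq (q := 5) (i := 2) (by norm_num) (by decide),
    nth_prime_eq (q := 7) (i := 3) (by norm_num) (by decide),
    nth_prime_eq (q := 11) (i := 4) (by norm_num) (by decide),
    nth_prime_eq (q := 13) (i := 5) (by norm_num) (by decide),
    nth_prime_eq (q := 17) (i := 6) (by norm_num) (by decide),
    nth_prime_eq (q := 19) (i := 7) (by norm_num) (by decide),
    nth_prime_eq (q := 23) (i := 8) (by norm_num) (by decide),
    nth_prime_eq (q := 29) (i := 9) (by norm_num) (by decide),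
    nth_prime_eq (q := 31) (i := 10) (by norm_num) (by decide),
    nth_prime_eq (q := 37) (i := 11) (by norm_num) (by decide)]
  norm_num

theorem pow_self_le_prod_nth_prime {k : ℕ} (hk : 13 ≤ k) :
    k ^ k ≤ ∏ i ∈ Finset.range k, Nat.nth Nat.Prime i := by
  induction k, hk using Nat.le_induction with
  | base =>
    have h : Nat.nth Nat.Prime 12 = 41 := nth_prime_eq (by norm_num) (by decide)
    rw [Finset.prod_range_succ, h]
    obtain ⟨-, -, -, -, -, -, -, -, h12⟩ := prod_nth_prime_range_eq
    rw [h12]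
    norm_num
  | succ k hk ih =>
    rw [Finset.prod_range_succ, pow_succ]
    calc (k + 1) ^ k * (k + 1) ≤ 3 * k ^ k * (k + 1) := by
          gcongr
          exact succ_pow_le_three_mul_pow k
      _ = k ^ k * (3 * (k + 1)) := by ring
      _ ≤ _ := Nat.mul_le_mul ih (three_mul_succ_le_nth_prime (by lia))

/-- The inequality `k * log x ≤ a * x` propagates to the right once `k ≤ a * c`. -/
theorem mul_log_le_mul_of_le {k a c L : ℝ} (hk : 0 ≤ k) (hc : 0 < c) (hkc : k ≤ a * c)
    (h : k * Real.log c ≤ a * c) (hcL : c ≤ L) : k * Real.log L ≤ a * L := by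
  have hL : 0 < L := hc.trans_le hcL
  have h1 := Real.log_le_sub_one_of_pos (div_pos hL hc)
  rw [Real.log_div hL.ne' hc.ne'] at h1
  have h2 := mul_le_mul_of_nonneg_left h1 hk
  have h3 : k * (L / c - 1) = k / c * (L - c) := by field_simp
  have h4 : k / c * (L - c) ≤ a * (L - c) :=
    mul_le_mul_of_nonneg_right ((div_le_iff₀ hc).mpr hkc) (by linarith)
  linarith

/-- A numerical criterion for `k * log (log x) ≤ 1.385 * log x` on `[P, ∞)`, with `u / v` a lower
bound for `log P` and `m / n` an upper bound for `log (u / v)`. -/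
theorem mul_log_log_le_of_certificate {k x : ℝ} (P u v m n : ℕ) (hPx : (P : ℝ) ≤ x)
    (hk : 0 ≤ k) (hu : 0 < u) (hv : 0 < v) (hn : 0 < n) (hP : 0 < P)
    (huv : (2.7182818286 : ℝ) ^ u ≤ (P : ℝ) ^ v)
    (hmn : ((u : ℝ) / v) ^ n ≤ 2.7182818283 ^ m)
    (hkc : k ≤ 1.385 * (u / v)) (hkm : k * (m / n) ≤ 1.385 * (u / v)) :
    k * Real.log (Real.log x) ≤ 1.385 * Real.log x := by
  have hu' : (0 : ℝ) < u := by exact_mod_cast hu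
  have hv' : (0 : ℝ) < v := by exact_mod_cast hv
  have hn' : (0 : ℝ) < n := by exact_mod_cast hn
  have hP' : (0 : ℝ) < P := by exact_mod_cast hP
  have hc : (0 : ℝ) < u / v := by positivity
  have hlogP : (u : ℝ) / v ≤ Real.log P := by
    rw [div_le_iff₀ hv', mul_comm, ← Real.log_pow, Real.le_log_iff_exp_le (by positivity),
      ← mul_one (u : ℝ), Real.exp_nat_mul]
    exact (pow_le_pow_left₀ (Real.exp_pos 1).le Real.exp_one_lt_d9.le u).trans huv
  have hlogc : Real.log ((u : ℝ) / v) ≤ m / n := by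
    rw [le_div_iff₀ hn', mul_comm, ← Real.log_pow, Real.log_le_iff_le_exp (by positivity),
      ← mul_one (m : ℝ), Real.exp_nat_mul]
    exact hmn.trans (pow_le_pow_left₀ (by norm_num) Real.exp_one_gt_d9.le m)
  exact mul_log_le_mul_of_le hk hc hkc ((mul_le_mul_of_nonneg_left hlogc hk).trans hkm)
    (hlogP.trans (Real.log_le_log hP' hPx))

theorem log_le_mul_self {y : ℝ} (hy : 0 < y) : Real.log y ≤ 0.385 * y := by
  have h1 := Real.log_le_sub_one_of_pos (div_pos hy (Real.exp_pos 1))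
  rw [Real.log_div hy.ne' (Real.exp_pos 1).ne', Real.log_exp] at h1
  have h2 : y / Real.exp 1 ≤ 0.385 * y := by
    rw [div_le_iff₀ (Real.exp_pos 1)]
    nlinarith [Real.exp_one_gt_d9]
  linarith

theorem mul_log_log_le_of_pow_self_le {k : ℕ} {x : ℝ} (hk : 3 ≤ k) (hx : (k : ℝ) ^ k ≤ x) :
    k * Real.log (Real.log x) ≤ 1.385 * Real.log x := by
  have hk3 : (3 : ℝ) ≤ k := by exact_mod_cast hk
  have hk0 : (0 : ℝ) < k := by linarith
  have he := Real.exp_one_lt_d9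
  have hlog : 1 ≤ Real.log k := by
    rw [Real.le_log_iff_exp_le hk0]
    linarith
  have hlog0 : 0 < Real.log k := by linarith
  have hloglog := log_le_mul_self hlog0
  refine mul_log_le_mul_of_le (c := k * Real.log k) hk0.le (by positivity) ?_ ?_ ?_
  · nlinarith
  · rw [Real.log_mul hk0.ne' hlog0.ne']
    nlinarith
  · rw [← Real.log_pow]
    exact Real.log_le_log (by positivity) hx

theorem mul_log_log_le_of_le_three {k x : ℝ} (hk0 : 0 ≤ k) (hk : k ≤ 3) (hx : 1 < x) :
    k * Real.log (Real.log x) ≤ 1.385 * Real.log x := by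
  have hL : 0 < Real.log x := Real.log_pos hx
  have h := log_le_mul_self hL
  nlinarith

theorem mul_log_log_le_of_prod_nth_prime_le {k : ℕ} {x : ℝ} (hx : 1 < x)
    (h : ((∏ i ∈ Finset.range k, Nat.nth Nat.Prime i : ℕ) : ℝ) ≤ x) :
    k * Real.log (Real.log x) ≤ 1.385 * Real.log x := by
  rcases Nat.lt_or_ge k 4 with h3 | h4
  · exact mul_log_log_le_of_le_three k.cast_nonneg (by exact_mod_cast Nat.le_of_lt_succ h3) hx
  rcases Nat.lt_or_ge k 13 with h12 | h13
  · obtain ⟨e4, e5, e6, e7, e8, e9, e10, e11, e12⟩ := prod_nth_prime_range_eq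
    interval_cases k <;> simp only [e4, e5, e6, e7, e8, e9, e10, e11, e12] at h
    · apply mul_log_log_le_of_certificate 210 5 1 5 3 h <;> norm_num
    · apply mul_log_log_le_of_certificate 2310 15 2 27 13 h <;> norm_num
    · apply mul_log_log_le_of_certificate 30030 10 1 30 13 h <;> norm_num
    · apply mul_log_log_le_of_certificate 510510 13 1 18 7 h <;> norm_num
    · apply mul_log_log_le_of_certificate 9699690 193 12 64 23 h <;> norm_num
    · apply mul_log_log_le_of_certificate 223092870 173 9 68 23 h <;> norm_num
    · apply mul_log_log_le_of_certificate 6469693230 45 2 81 26 h <;> norm_num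
    · apply mul_log_log_le_of_certificate 200560490130 26 1 36 11 h <;> norm_num
    · apply mul_log_log_le_of_certificate 7420738134810 59 2 17 5 h <;> norm_num
  · refine mul_log_log_le_of_pow_self_le (by lia) (le_trans ?_ h)
    exact_mod_cast pow_self_le_prod_nth_prime h13

theorem stmt5 (p : ℕ) (hp : p.Prime) (h5 : 5 ≤ p) :
    ((p - 1).primeFactors.card : ℝ) ≤ 1.385 * Real.log p / Real.log (Real.log p) := by
  have hp5 : (5 : ℝ) ≤ p := by exact_mod_cast h5
  have hlog : 1 < Real.log p := by
    rw [Real.lt_log_iff_exp_lt (by linarith)]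
    linarith [Real.exp_one_lt_d9]
  rw [le_div_iff₀ (Real.log_pos hlog)]
  refine mul_log_log_le_of_prod_nth_prime_le (by linarith) ?_
  have h1 := prod_nth_prime_le_prod _ (p - 1).primeFactors
    (fun q hq => Nat.prime_of_mem_primeFactors hq) rfl
  have h2 := Nat.le_of_dvd (by lia) (Nat.prod_primeFactors_dvd (p - 1))
  exact_mod_cast (h1.trans h2).trans (Nat.sub_le p 1)
end
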